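/- Let f : 𝕋 → ℝ be a continuous real-valued function on the circle 𝕋 = ℝ/2πℤ. Then there exist a homeomorphism h of 𝕋 onto itself and a continuous function v : 𝕋 → ℝ of bounded variation on 𝕋 such that v̂(k) = -i·sgn(k)·(f∘h)^(k) for every k ∈ ℤ, and moreover both v and h have the logarithmic modulus of continuity: there is a constant C > 0 such that |v(s) − v(t)| ≤ C/log(1/dist(s,t)) and dist(h(s), h(t)) ≤ C/log(1/dist(s,t)) whenever 0 < dist(s,t) ≤ 1/2, where dist is the natural metric on 𝕋. -/

import Mathlib

namespace JW
open Real MeasureTheory Set Filter Topology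

lemma hasSum_congr {ι : Type*} {f g : ι → ℂ} {a : ℂ} (h : ∀ k, f k = g k) :
    HasSum f a ↔ HasSum g a := by rw [funext h]

noncomputable def Fc (g : ℝ → ℂ) (m : ℤ) : ℂ :=
  ∫ t in (0:ℝ)..2*π, g t * Complex.exp (Complex.I * m * t)

lemma exp_periodic (m : ℤ) :
    Function.Periodic (fun t : ℝ => Complex.exp (Complex.I * m * t)) (2*π) := by
  intro t
  simp only
  rw [Complex.exp_eq_exp_iff_exists_int]
  exact ⟨m, by push_cast; ring⟩

lemma periodic_shift {E : Type*} [NormedAddCommGroup E] [NormedSpace ℝ E]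
    {G : ℝ → E} (hG : Function.Periodic G (2*π)) (c : ℝ) :
    ∫ τ in (0:ℝ)..2*π, G (c + τ) = ∫ t in (0:ℝ)..2*π, G t := by
  rw [intervalIntegral.integral_comp_add_left, add_zero]
  simpa using hG.intervalIntegral_add_eq c 0

lemma Fc_shift {g : ℝ → ℂ} (hp : Function.Periodic g (2*π)) (c : ℝ) (m : ℤ) :
    Fc (fun τ => g (c + τ)) m = Complex.exp (-(Complex.I * m * c)) * Fc g m := by
  have h := periodic_shift (G := fun t => g t * Complex.exp (Complex.I * m * t))
    (hp.mul (exp_periodic m)) c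
  unfold Fc
  rw [← h, ← intervalIntegral.integral_const_mul]
  congr 1; ext τ
  push_cast
  rw [mul_add, Complex.exp_add, Complex.exp_neg]
  field_simp [Complex.exp_ne_zero]

lemma norm_exp_I (m : ℤ) (t : ℝ) : ‖Complex.exp (Complex.I * m * t)‖ = 1 := by
  rw [show Complex.I * m * t = ((m * t : ℝ) : ℂ) * Complex.I by push_cast; ring]
  exact Complex.norm_exp_ofReal_mul_I _

lemma hasSum_pair {g : ℝ → ℂ} (hg : Continuous g) (hp : Function.Periodic g (2*π)) (c : ℝ)
    (a : ℕ → ℝ) (ha : Summable fun k => |a k|) (S : ℝ → ℂ)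
    (hS : ∀ τ : ℝ, HasSum (fun k : ℕ => (a k : ℂ) * Complex.exp (Complex.I * ((k+1 : ℕ) : ℤ) * τ)) (S τ)) :
    HasSum (fun k : ℕ => (a k : ℂ) * (Complex.exp (-(Complex.I * ((k+1 : ℕ) : ℤ) * c)) * Fc g ((k+1 : ℕ) : ℤ)))
      (∫ τ in (0:ℝ)..2*π, g (c + τ) * S τ) := by
  obtain ⟨M, hM⟩ : ∃ M, ∀ x ∈ Icc c (c + 2*π), ‖g x‖ ≤ M :=
    isCompact_Icc.exists_bound_of_continuousOn hg.continuousOn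
  have key := intervalIntegral.hasSum_integral_of_dominated_convergence
    (μ := volume) (a := 0) (b := 2*π)
    (F := fun (k : ℕ) (τ : ℝ) => g (c+τ) * ((a k : ℂ) * Complex.exp (Complex.I * ((k+1 : ℕ) : ℤ) * τ)))
    (f := fun τ => g (c + τ) * S τ) (fun k _ => M * |a k|)
    (fun k => by
      apply Continuous.aestronglyMeasurable; fun_prop)
    (fun k => by
      refine Eventually.of_forall fun t ht => ?_
      rw [uIoc_of_le (by positivity)] at ht
      rw [norm_mul, norm_mul, norm_exp_I, mul_one, Complex.norm_real, Real.norm_eq_abs]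
      gcongr
      exact hM _ ⟨by linarith [ht.1], by linarith [ht.2]⟩)
    (Eventually.of_forall fun t _ => ha.mul_left M)
    (by simp)
    (Eventually.of_forall fun t _ => (hS t).mul_left _)
  refine (hasSum_congr fun k => ?_).2 key
  rw [← Fc_shift hp, Fc, ← intervalIntegral.integral_const_mul]
  congr 1; ext τ; ring

lemma norm_rho_exp {ρ : ℝ} (h0 : 0 ≤ ρ) (τ : ℝ) : ‖(ρ : ℂ) * Complex.exp (Complex.I * τ)‖ = ρ := by
  have := norm_exp_I 1 τ
  simp only [Int.cast_one, mul_one] at this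
  rw [norm_mul, this, Complex.norm_real, Real.norm_eq_abs, abs_of_nonneg h0, mul_one]

lemma zeta_pow (ρ τ : ℝ) (k : ℕ) : ((ρ:ℂ) * Complex.exp (Complex.I * τ))^k
    = ((ρ^k : ℝ):ℂ) * Complex.exp (Complex.I * (k:ℤ) * τ) := by
  rw [mul_pow, ← Complex.exp_nat_mul]; push_cast; congr 2; ring

lemma hasSum_geo {ρ : ℝ} (h0 : 0 ≤ ρ) (h1 : ρ < 1) (τ : ℝ) :
    HasSum (fun k : ℕ => ((ρ^(k+1) : ℝ) : ℂ) * Complex.exp (Complex.I * ((k+1 : ℕ) : ℤ) * τ))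
     (((ρ:ℂ) * Complex.exp (Complex.I * τ)) / (1 - (ρ:ℂ) * Complex.exp (Complex.I * τ))) := by
  have h := (hasSum_geometric_of_norm_lt_one (ξ := (ρ:ℂ) * Complex.exp (Complex.I * τ))
    (by rw [norm_rho_exp h0]; exact h1)).mul_left ((ρ:ℂ) * Complex.exp (Complex.I * τ))
  rw [div_eq_mul_inv]
  refine (hasSum_congr fun k => ?_).2 h
  rw [← pow_succ', zeta_pow]

lemma hasSum_geo2 {ρ : ℝ} (h0 : 0 ≤ ρ) (h1 : ρ < 1) (τ : ℝ) :
    HasSum (fun k : ℕ => (((k+1:ℕ) * ρ^(k+1) : ℝ) : ℂ) * Complex.exp (Complex.I * ((k+1 : ℕ) : ℤ) * τ))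
     (((ρ:ℂ) * Complex.exp (Complex.I * τ)) / (1 - (ρ:ℂ) * Complex.exp (Complex.I * τ))^2) := by
  have h := (hasSum_coe_mul_geometric_of_norm_lt_one (r := (ρ:ℂ) * Complex.exp (Complex.I * τ))
    (by rw [norm_rho_exp h0]; exact h1))
  rw [← hasSum_nat_add_iff' 1] at h
  simp only [Finset.range_one, Finset.sum_singleton, Nat.cast_zero, zero_mul, sub_zero] at h
  refine (hasSum_congr fun k => ?_).2 h
  rw [zeta_pow]; push_cast; ring

lemma summable_geo {ρ : ℝ} (h0 : 0 ≤ ρ) (h1 : ρ < 1) : Summable fun k : ℕ => |ρ^(k+1)| := by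
  simp only [abs_of_nonneg (pow_nonneg h0 _)]
  exact (summable_nat_add_iff 1).2 (summable_geometric_of_lt_one h0 h1)

lemma summable_geo2 {ρ : ℝ} (h0 : 0 ≤ ρ) (h1 : ρ < 1) :
    Summable fun k : ℕ => |((k+1:ℕ):ℝ) * ρ^(k+1)| := by
  have : Summable fun k : ℕ => ((k:ℕ):ℝ) * ρ^k :=
    (hasSum_coe_mul_geometric_of_norm_lt_one (r := ρ) (by rwa [Real.norm_eq_abs, abs_of_nonneg h0])).summable
  refine ((summable_nat_add_iff 1).2 this).congr fun k => ?_
  rw [abs_of_nonneg (by positivity)]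

end JW


namespace JW
open Real MeasureTheory Set Filter Topology

structure IsLift (h : ℝ → ℝ) : Prop where
  cont : Continuous h
  mono : Monotone h
  per : ∀ t, h (t + 2*π) = h t + 2*π

noncomputable def qk (ρ τ : ℝ) : ℝ := ρ * Real.sin τ / (1 - 2*ρ*Real.cos τ + ρ^2)

lemma den_pos {ρ : ℝ} (h1 : ρ < 1) (h0 : 0 ≤ ρ) (τ : ℝ) : 0 < 1 - 2*ρ*Real.cos τ + ρ^2 := by
  nlinarith [Real.cos_le_one τ, sq_nonneg (1-ρ), mul_nonneg h0 (sub_nonneg.2 (Real.cos_le_one τ)),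
    mul_pos (sub_pos.2 h1) (sub_pos.2 h1)]

lemma qk_cont {ρ : ℝ} (h0 : 0 ≤ ρ) (h1 : ρ < 1) : Continuous (qk ρ) := by
  unfold qk
  exact Continuous.div (by fun_prop) (by fun_prop) fun τ => (den_pos h1 h0 τ).ne'

lemma qk_per (ρ : ℝ) : Function.Periodic (qk ρ) (2*π) := by
  intro t; simp [qk, Real.sin_add_two_pi, Real.cos_add_two_pi]

lemma qk_odd (ρ τ : ℝ) : qk ρ (-τ) = - qk ρ τ := by
  simp [qk, neg_div]

lemma IsLift.vper {h : ℝ → ℝ} (hh : IsLift h) : Function.Periodic (fun t => h t - t) (2*π) := by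
  intro t; simp only [hh.per]; ring

lemma tau_qk {ρ : ℝ} (h0 : 0 ≤ ρ) (h1 : ρ < 1) {τ : ℝ} (hτ0 : 0 ≤ τ) (hτ : τ ≤ π) :
    τ * qk ρ τ ≤ 1 := by
  unfold qk
  rw [← mul_div_assoc, div_le_one (den_pos h1 h0 τ)]
  have key : τ/2 * Real.cos (τ/2) ≤ Real.sin (τ/2) := by
    rcases hτ.eq_or_lt with rfl | hlt
    · simp
    · have hc : 0 < Real.cos (τ/2) := Real.cos_pos_of_mem_Ioo ⟨by linarith [Real.pi_pos], by linarith⟩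
      have := Real.le_tan (x := τ/2) (by linarith) (by linarith)
      rw [Real.tan_eq_sin_div_cos, le_div_iff₀ hc] at this
      exact this
  have hs : 0 ≤ Real.sin (τ/2) := Real.sin_nonneg_of_nonneg_of_le_pi (by linarith) (by linarith)
  have e1 : Real.sin τ = 2 * Real.sin (τ/2) * Real.cos (τ/2) := by
    rw [← Real.sin_two_mul]; congr 1; ring
  have e2 : Real.cos τ = 1 - 2 * Real.sin (τ/2)^2 := by
    rw [← Real.cos_two_mul_eq_one_sub]; congr 1; ring
  rw [e1, e2]
  have := mul_le_mul_of_nonneg_left key hs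
  nlinarith [mul_le_mul_of_nonneg_left this h0, sq_nonneg (1-ρ)]

lemma integral_qk {ρ : ℝ} (h0 : 0 ≤ ρ) (h1 : ρ < 1) (d : ℝ) :
    ∫ τ in d..π, qk ρ τ = (Real.log ((1+ρ)^2) - Real.log (1 - 2*ρ*Real.cos d + ρ^2))/2 := by
  have hd : ∀ τ ∈ uIcc d π, HasDerivAt (fun τ => Real.log (1 - 2*ρ*Real.cos τ + ρ^2) / 2) (qk ρ τ) τ := by
    intro τ _
    have h : HasDerivAt (fun τ => 1 - 2*ρ*Real.cos τ + ρ^2) (2*ρ*Real.sin τ) τ := by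
      have := (((Real.hasDerivAt_cos τ).const_mul (2*ρ)).const_sub 1).add_const (ρ^2)
      exact this.congr_deriv (by ring)
    have := (h.log (den_pos h1 h0 τ).ne').div_const 2
    exact this.congr_deriv (by unfold qk; field_simp)
  rw [intervalIntegral.integral_eq_sub_of_hasDerivAt hd ((qk_cont h0 h1).intervalIntegrable _ _)]
  rw [Real.cos_pi]; ring_nf

lemma core {h : ℝ → ℝ} (hh : IsLift h) (c : ℝ) {d : ℝ} (hd0 : 0 < d) (hd : d ≤ 1/2) :
    (h (c+d) - h (c-d)) * Real.log (1/d) ≤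
      |∫ τ in (0:ℝ)..2*π, (h (c+τ) - (c+τ)) * qk (1-d) τ| + 2*π := by
  have hπ := Real.pi_gt_three
  have h0 : 0 ≤ 1 - d := by linarith
  have h1 : 1 - d < 1 := by linarith
  have hqc := qk_cont h0 h1
  have hc := hh.cont
  have e1 : ∫ τ in (0:ℝ)..2*π, (h (c+τ) - (c+τ)) * qk (1-d) τ
      = ∫ τ in (0:ℝ)..π, (h (c+τ) - h (c-τ)) * qk (1-d) τ - 2 * (τ * qk (1-d) τ) := by
    have hP : Function.Periodic (fun τ => (h (c+τ) - (c+τ)) * qk (1-d) τ) (2*π) := by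
      intro τ
      have := hh.vper (c+τ)
      simp only at this ⊢
      rw [qk_per, ← add_assoc, this]
    have h2 := hP.intervalIntegral_add_eq 0 (-π)
    rw [zero_add] at h2
    rw [h2, show -π + 2*π = π by ring]
    have hI : ∀ a b : ℝ, IntervalIntegrable (fun τ => (h (c+τ) - (c+τ)) * qk (1-d) τ) volume a b :=
      fun a b => Continuous.intervalIntegrable (by fun_prop) _ _
    rw [← intervalIntegral.integral_add_adjacent_intervals (hI (-π) 0) (hI 0 π)]
    have h3 : ∫ τ in (-π)..0, (h (c+τ) - (c+τ)) * qk (1-d) τ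
        = ∫ τ in (0:ℝ)..π, - ((h (c-τ) - (c-τ)) * qk (1-d) τ) := by
      have := intervalIntegral.integral_comp_neg (a := 0) (b := π)
        (fun τ => (h (c+τ) - (c+τ)) * qk (1-d) τ)
      rw [neg_zero] at this
      rw [← this]
      congr 1; ext τ; rw [qk_odd]; simp only [← sub_eq_add_neg]; ring
    rw [h3, ← intervalIntegral.integral_add (Continuous.intervalIntegrable (by fun_prop) _ _) (hI 0 π)]
    congr 1; ext τ; ring
  have hqn : ∀ τ ∈ Icc (0:ℝ) π, 0 ≤ qk (1-d) τ := fun τ hτ =>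
    div_nonneg (mul_nonneg h0 (Real.sin_nonneg_of_nonneg_of_le_pi hτ.1 hτ.2)) (den_pos h1 h0 τ).le
  have hjn : 0 ≤ h (c+d) - h (c-d) := sub_nonneg.2 (hh.mono (by linarith))
  have hII : ∀ a b : ℝ, IntervalIntegrable (fun τ => (h (c+τ) - h (c-τ)) * qk (1-d) τ) volume a b :=
      fun a b => Continuous.intervalIntegrable (by fun_prop) _ _
  have e2 : (h (c+d) - h (c-d)) * Real.log (1/d) ≤ ∫ τ in (0:ℝ)..π, (h (c+τ) - h (c-τ)) * qk (1-d) τ := by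
    rw [← intervalIntegral.integral_add_adjacent_intervals (hII 0 d) (hII d π)]
    have a1 : 0 ≤ ∫ τ in (0:ℝ)..d, (h (c+τ) - h (c-τ)) * qk (1-d) τ := by
      apply intervalIntegral.integral_nonneg hd0.le
      intro τ hτ
      exact mul_nonneg (sub_nonneg.2 (hh.mono (by linarith [hτ.1]))) (hqn τ ⟨hτ.1, by linarith [hτ.2]⟩)
    have a2 : (h (c+d) - h (c-d)) * ∫ τ in d..π, qk (1-d) τ ≤ ∫ τ in d..π, (h (c+τ) - h (c-τ)) * qk (1-d) τ := by
      rw [← intervalIntegral.integral_const_mul]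
      apply intervalIntegral.integral_mono_on (by linarith) (Continuous.intervalIntegrable (by fun_prop) _ _) (hII d π)
      intro τ hτ
      apply mul_le_mul_of_nonneg_right _ (hqn τ ⟨by linarith [hτ.1], hτ.2⟩)
      exact sub_le_sub (hh.mono (by linarith [hτ.1])) (hh.mono (by linarith [hτ.1]))
    have a3 : Real.log (1/d) ≤ ∫ τ in d..π, qk (1-d) τ := by
      rw [integral_qk h0 h1, ← Real.log_div (by positivity) (den_pos h1 h0 d).ne', le_div_iff₀ two_pos,
        mul_comm, ← Real.log_rpow (by positivity)]
      apply Real.log_le_log (by positivity)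
      rw [le_div_iff₀ (den_pos h1 h0 d)]
      have := Real.one_sub_sq_div_two_le_cos (x := d)
      norm_num
      rw [inv_mul_le_iff₀ (by positivity)]
      nlinarith [mul_le_mul_of_nonneg_left this h0, mul_pos hd0 hd0]
    nlinarith [mul_le_mul_of_nonneg_left a3 hjn]
  have e3 : ∫ τ in (0:ℝ)..π, 2 * (τ * qk (1-d) τ) ≤ 2*π := by
    have : ∫ τ in (0:ℝ)..π, 2 * (τ * qk (1-d) τ) ≤ ∫ τ in (0:ℝ)..π, (2:ℝ) := by
      apply intervalIntegral.integral_mono_on Real.pi_pos.le (Continuous.intervalIntegrable (by fun_prop) _ _)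
        (Continuous.intervalIntegrable (by fun_prop) _ _)
      intro τ hτ
      linarith [tau_qk h0 h1 hτ.1 hτ.2]
    simpa [mul_comm] using this
  rw [e1, intervalIntegral.integral_sub (hII _ _) (Continuous.intervalIntegrable (by fun_prop) _ _)]
  have := le_abs_self ((∫ τ in (0:ℝ)..π, (h (c+τ) - h (c-τ)) * qk (1-d) τ) - ∫ τ in (0:ℝ)..π, 2 * (τ * qk (1-d) τ))
  linarith

lemma one_sub_ne {ρ : ℝ} (h0 : 0 ≤ ρ) (h1 : ρ < 1) (τ : ℝ) :
    (1 - (ρ:ℂ) * Complex.exp (Complex.I * τ)) ≠ 0 := by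
  intro h
  have := norm_rho_exp h0 τ
  rw [← sub_eq_zero.1 h] at this
  simp at this; linarith

lemma im_zeta {ρ : ℝ} (h0 : 0 ≤ ρ) (h1 : ρ < 1) (τ : ℝ) :
    (((ρ:ℂ) * Complex.exp (Complex.I * τ)) / (1 - (ρ:ℂ) * Complex.exp (Complex.I * τ)))
     = (((ρ * Real.cos τ - ρ^2) / (1 - 2*ρ*Real.cos τ + ρ^2) : ℝ) : ℂ) + (qk ρ τ : ℂ) * Complex.I := by
  rw [div_eq_iff (one_sub_ne h0 h1 τ)]
  have e : Complex.exp (Complex.I * τ) = (Real.cos τ : ℂ) + (Real.sin τ : ℂ) * Complex.I := by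
    rw [mul_comm, Complex.exp_mul_I]; simp
  rw [e]
  have hsc := Real.sin_sq_add_cos_sq τ
  have hD := (den_pos h1 h0 τ).ne'
  unfold qk
  generalize Real.cos τ = C at *
  generalize Real.sin τ = S at *
  have hsc' : (S:ℂ)^2 + (C:ℂ)^2 = 1 := by exact_mod_cast hsc
  have hD' : (1 - 2 * (ρ:ℂ) * C + (ρ:ℂ)^2) ≠ 0 := by exact_mod_cast hD
  have hI := Complex.I_sq
  push_cast
  obtain ⟨D, hDe⟩ : ∃ D : ℂ, D = 1 - 2 * (ρ:ℂ) * C + (ρ:ℂ)^2 := ⟨_, rfl⟩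
  rw [← hDe] at hD' ⊢
  field_simp
  rw [hDe]
  linear_combination ((ρ:ℂ)* S^2*ρ ) * hI - (ρ:ℂ)^2 * hsc'

end JW


namespace JW
open Real MeasureTheory Set Filter Topology

noncomputable def Rk (ρ τ : ℝ) : ℝ := (ρ * Real.cos τ - ρ^2) / (1 - 2*ρ*Real.cos τ + ρ^2)

lemma Rk_cont {ρ : ℝ} (h0 : 0 ≤ ρ) (h1 : ρ < 1) : Continuous (Rk ρ) := by
  unfold Rk
  exact Continuous.div (by fun_prop) (by fun_prop) fun τ => (den_pos h1 h0 τ).ne'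

lemma abs_Rk_le {ρ : ℝ} (h0 : 0 ≤ ρ) (h1 : ρ < 1) (τ : ℝ) : |Rk ρ τ| ≤ Rk ρ τ + 1 := by
  have hD := den_pos h1 h0 τ
  have : -(1/2) ≤ Rk ρ τ := by
    unfold Rk
    rw [le_div_iff₀ hD]
    nlinarith
  rw [abs_le]; constructor <;> linarith

lemma Fc_one (m : ℕ) : Fc (fun _ => 1) ((m+1:ℕ):ℤ) = 0 := by
  unfold Fc
  have hc : Complex.I * (((m+1:ℕ):ℤ):ℂ) ≠ 0 := by
    apply mul_ne_zero Complex.I_ne_zero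
    exact_mod_cast Nat.succ_ne_zero m
  simp only [one_mul]
  rw [integral_exp_mul_complex hc]
  have := exp_periodic ((m+1:ℕ):ℤ) 0
  simp only [zero_add] at this
  rw [this]; simp

lemma pair_zero {g : ℝ → ℂ} (hg : Continuous g) (hp : Function.Periodic g (2*π))
    (h : ∀ m : ℕ, Fc g ((m+1:ℕ):ℤ) = 0) (c : ℝ) {ρ : ℝ} (h0 : 0 ≤ ρ) (h1 : ρ < 1) :
    ∫ τ in (0:ℝ)..2*π, g (c+τ) * ((Rk ρ τ : ℂ) + (qk ρ τ : ℂ) * Complex.I) = 0 := by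
  have := hasSum_pair hg hp c _ (summable_geo h0 h1) _ (fun τ => hasSum_geo h0 h1 τ)
  simp only [h, mul_zero, im_zeta h0 h1] at this
  exact (this.unique hasSum_zero)

lemma integral_Rk {ρ : ℝ} (h0 : 0 ≤ ρ) (h1 : ρ < 1) : ∫ τ in (0:ℝ)..2*π, Rk ρ τ = 0 := by
  have := pair_zero (g := fun _ => 1) continuous_const (fun _ => rfl) Fc_one 0 h0 h1
  simp only [one_mul] at this
  have hR := Rk_cont h0 h1
  have hq := qk_cont h0 h1
  have h2 := congrArg Complex.re this
  rw [← Complex.reCLM_apply, ← ContinuousLinearMap.intervalIntegral_comp_comm _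
    (Continuous.intervalIntegrable (by fun_prop) _ _)] at h2
  simpa using h2

lemma conj_mod {h u : ℝ → ℝ} (hh : IsLift h) (hu : Continuous u) (hup : Function.Periodic u (2*π))
    {M : ℝ} (hM : ∀ t, |u t| ≤ M)
    (hc : ∀ m : ℕ, Fc (fun t => (u t : ℂ) + ((h t - t : ℝ) : ℂ) * Complex.I) ((m+1:ℕ):ℤ) = 0)
    (c : ℝ) {d : ℝ} (hd0 : 0 < d) (hd : d ≤ 1/2) :
    (h (c+d) - h (c-d)) * Real.log (1/d) ≤ 2*π*M + 2*π := by
  refine (core hh c hd0 hd).trans ?_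
  gcongr
  have h0 : 0 ≤ 1 - d := by linarith
  have h1 : 1 - d < 1 := by linarith
  have hhc := hh.cont
  have hR := Rk_cont h0 h1
  have hq := qk_cont h0 h1
  have hp := pair_zero (g := fun t => (u t : ℂ) + ((h t - t : ℝ) : ℂ) * Complex.I) (by fun_prop)
    (fun t => by
      have := hh.vper t
      simp only at this ⊢
      rw [hup t, this]) hc c h0 h1
  have h2 := congrArg Complex.re hp
  rw [← Complex.reCLM_apply, ← ContinuousLinearMap.intervalIntegral_comp_comm _
    (Continuous.intervalIntegrable (by fun_prop) _ _)] at h2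
  have e : ∀ τ, Complex.reCLM (((u (c+τ) : ℂ) + ((h (c+τ) - (c+τ) : ℝ) : ℂ) * Complex.I) *
    ((Rk (1-d) τ : ℂ) + (qk (1-d) τ : ℂ) * Complex.I)) = u (c+τ) * Rk (1-d) τ - (h (c+τ) - (c+τ)) * qk (1-d) τ := by
    intro τ
    rw [Complex.reCLM_apply, Complex.mul_re]
    simp only [Complex.add_re, Complex.add_im, Complex.re_ofReal_mul, Complex.im_ofReal_mul, Complex.ofReal_re,
      Complex.ofReal_im, Complex.I_re, Complex.I_im]
    ring
  simp only [e] at h2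
  rw [intervalIntegral.integral_sub (Continuous.intervalIntegrable (by fun_prop) _ _)
    (Continuous.intervalIntegrable (by fun_prop) _ _), Complex.zero_re, sub_eq_zero] at h2
  rw [← h2]
  have h3 : |∫ τ in (0:ℝ)..2*π, u (c+τ) * Rk (1-d) τ| ≤ ∫ τ in (0:ℝ)..2*π, M * (Rk (1-d) τ + 1) := by
    refine (intervalIntegral.abs_integral_le_integral_abs (by positivity)).trans ?_
    apply intervalIntegral.integral_mono_on (by positivity) (Continuous.intervalIntegrable (by fun_prop) _ _)
      (Continuous.intervalIntegrable (by fun_prop) _ _)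
    intro τ _
    rw [abs_mul]
    exact mul_le_mul (hM _) (abs_Rk_le h0 h1 τ) (abs_nonneg _) ((abs_nonneg _).trans (hM 0))
  refine h3.trans (le_of_eq ?_)
  rw [intervalIntegral.integral_const_mul, intervalIntegral.integral_add (hR.intervalIntegrable _ _)
    (Continuous.intervalIntegrable (by fun_prop) _ _), integral_Rk h0 h1]
  simp; ring

lemma energy_mod {h : ℝ → ℝ} (hh : IsLift h) {A : ℝ}
    (hs : Summable fun k : ℕ => ((k:ℝ)+1) * ‖Fc (fun t => ((h t - t : ℝ):ℂ)) ((k+1:ℕ):ℤ)‖^2)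
    (hA : ∑' k : ℕ, ((k:ℝ)+1) * ‖Fc (fun t => ((h t - t : ℝ):ℂ)) ((k+1:ℕ):ℤ)‖^2 ≤ A)
    (c : ℝ) {d : ℝ} (hd0 : 0 < d) (hd : d ≤ 1/2) {η : ℝ} (hη : 0 < η) :
    (h (c+d) - h (c-d)) * Real.log (1/d) ≤ η * Real.log (1/d) + A/(4*η) + 2*π := by
  refine (core hh c hd0 hd).trans ?_
  gcongr
  have h0 : 0 ≤ 1 - d := by linarith
  have h1 : 1 - d < 1 := by linarith
  have hhc := hh.cont
  have hR := Rk_cont h0 h1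
  have hq := qk_cont h0 h1
  set ρ := 1 - d with hρ
  set x : ℕ → ℝ := fun k => ‖Fc (fun t => ((h t - t : ℝ):ℂ)) ((k+1:ℕ):ℤ)‖ with hx
  have hp := hasSum_pair (g := fun t => ((h t - t : ℝ):ℂ)) (by fun_prop)
    (fun t => by
      have := hh.vper t
      simp only at this ⊢
      rw [this]) c _ (summable_geo h0 h1) _ (fun τ => hasSum_geo h0 h1 τ)
  have hlog := (Real.hasSum_pow_div_log_of_abs_lt_one (x := ρ^2) (by
    rw [abs_of_nonneg (by positivity)]; nlinarith)).mul_left η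
  have hnorm : ∀ k : ℕ, ‖((ρ^(k+1) : ℝ) : ℂ) * (Complex.exp (-(Complex.I * ((k+1 : ℕ) : ℤ) * c)) *
      Fc (fun t => ((h t - t : ℝ):ℂ)) ((k+1 : ℕ) : ℤ))‖ = ρ^(k+1) * x k := by
    intro k
    rw [norm_mul, norm_mul, Complex.norm_real, Real.norm_eq_abs, abs_of_nonneg (by positivity)]
    have := norm_exp_I ((k+1:ℕ):ℤ) (-c)
    rw [show Complex.I * (((k+1:ℕ):ℤ):ℂ) * ((-c:ℝ):ℂ) = -(Complex.I * (((k+1:ℕ):ℤ):ℂ) * c) by push_cast; ring] at this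
    rw [this, one_mul]
  have hle : ∀ k : ℕ, ρ^(k+1) * x k ≤ η * ((ρ^2)^(k+1)/((k:ℝ)+1)) + (((k:ℝ)+1) * x k^2) / (4*η) := by
    intro k
    have hk : (0:ℝ) < (k:ℝ)+1 := by positivity
    rw [← pow_mul, mul_comm 2, pow_mul]
    generalize ρ^(k+1) = r
    generalize x k = y
    have : 0 ≤ (2*η*r - ((k:ℝ)+1)*y)^2 / (4*η*((k:ℝ)+1)) := by positivity
    have e : (2*η*r - ((k:ℝ)+1)*y)^2 / (4*η*((k:ℝ)+1)) = η * (r^2/((k:ℝ)+1)) + (((k:ℝ)+1) * y^2) / (4*η) - r*y := by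
      field_simp; ring
    linarith
  have hS2 : HasSum (fun k : ℕ => η * ((ρ^2)^(k+1)/((k:ℝ)+1)) + (((k:ℝ)+1) * x k^2) / (4*η))
    (η * -Real.log (1-ρ^2) + (∑' k : ℕ, ((k:ℝ)+1) * x k^2)/(4*η)) := hlog.add (hs.hasSum.div_const _)
  have hb : ‖∫ τ in (0:ℝ)..2*π, ((h (c+τ) - (c+τ) : ℝ):ℂ) * (((ρ:ℂ) * Complex.exp (Complex.I * τ)) / (1 - (ρ:ℂ) * Complex.exp (Complex.I * τ)))‖ ≤
      η * -Real.log (1-ρ^2) + (∑' k : ℕ, ((k:ℝ)+1) * x k^2)/(4*η) := by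
    rw [← hp.tsum_eq]
    exact tsum_of_norm_bounded hS2 (fun k => (hnorm k).trans_le (hle k))
  have him : |∫ τ in (0:ℝ)..2*π, (h (c+τ) - (c+τ)) * qk ρ τ| ≤ ‖∫ τ in (0:ℝ)..2*π, ((h (c+τ) - (c+τ) : ℝ):ℂ) * (((ρ:ℂ) * Complex.exp (Complex.I * τ)) / (1 - (ρ:ℂ) * Complex.exp (Complex.I * τ)))‖ := by
    refine le_trans (le_of_eq ?_) (Complex.abs_im_le_norm _)
    simp only [im_zeta h0 h1]
    change _ = |(∫ τ in (0:ℝ)..2*π, ((h (c+τ) - (c+τ) : ℝ):ℂ) * ((Rk ρ τ : ℂ) + (qk ρ τ : ℂ) * Complex.I)).im|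
    rw [← Complex.imCLM_apply, ← ContinuousLinearMap.intervalIntegral_comp_comm _
      (Continuous.intervalIntegrable (by fun_prop) _ _)]
    congr 2; ext τ
    rw [Complex.imCLM_apply, Complex.im_ofReal_mul]
    simp
  refine him.trans (hb.trans ?_)
  gcongr
  rw [one_div, Real.log_inv, neg_le_neg_iff]
  apply Real.log_le_log hd0
  rw [hρ]; nlinarith

lemma IsLift.close {h : ℝ → ℝ} (hh : IsLift h) (h00 : 0 ≤ h 0) (h01 : h 0 ≤ 2*π) (t : ℝ) : |h t - t| ≤ 4*π := by
  have hp := Real.pi_pos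
  obtain ⟨y, hy, hy2⟩ := hh.vper.exists_mem_Ico₀ (by positivity) t
  change h t - t = h y - y at hy2
  rw [hy2, abs_le]
  have a := hh.mono hy.1
  have b := hh.mono hy.2.le
  have := hh.per 0
  rw [zero_add] at this
  constructor <;> linarith [hy.1, hy.2]

lemma lift_compact {h : ℕ → ℝ → ℝ} (hh : ∀ n, IsLift (h n)) (h0 : ∀ n, 0 ≤ h n 0 ∧ h n 0 ≤ 2*π)
    (heq : ∀ ε > 0, ∃ d > 0, ∀ n c, h n (c+d) - h n (c-d) ≤ ε) :
    ∃ φ : ℕ → ℕ, StrictMono φ ∧ ∃ g, IsLift g ∧ (0 ≤ g 0 ∧ g 0 ≤ 2*π) ∧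
      ∀ t, Tendsto (fun n => h (φ n) t) atTop (𝓝 (g t)) := by
  have hK : IsCompact (Set.pi univ fun q : ℚ => Icc ((q:ℝ) - 4*π) (q + 4*π)) :=
    isCompact_univ_pi fun q => isCompact_Icc
  obtain ⟨a, -, φ, hφ, hlim⟩ := hK.tendsto_subseq (x := fun n (q:ℚ) => h n q) (fun n q _ => by
    have := abs_le.1 ((hh n).close (h0 n).1 (h0 n).2 q)
    constructor <;> linarith)
  rw [tendsto_pi_nhds] at hlim
  have hca : ∀ t, CauchySeq fun n => h (φ n) t := by
    intro t
    rw [Metric.cauchySeq_iff']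
    intro ε hε
    obtain ⟨d, hd, hde⟩ := heq (ε/4) (by positivity)
    obtain ⟨q, hq1, hq2⟩ := exists_rat_btwn (show t < t + d by linarith)
    have hcq := (hlim q).cauchySeq
    rw [Metric.cauchySeq_iff'] at hcq
    obtain ⟨N, hN⟩ := hcq (ε/4) (by positivity)
    refine ⟨N, fun n hn => ?_⟩
    have h1 := hN n hn
    simp only [Function.comp] at h1
    have key : ∀ n, |h n q - h n t| ≤ ε/4 := by
      intro n
      have a1 := (hh n).mono hq1.le
      have a2 := (hh n).mono hq2.le
      have a3 := (hh n).mono (show t - d ≤ t by linarith)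
      rw [abs_le]; constructor <;> linarith [hde n t]
    have k1 := abs_le.1 (key (φ n))
    have k2 := abs_le.1 (key (φ N))
    rw [Real.dist_eq, abs_lt] at *
    constructor <;> linarith [h1.1, h1.2]
  choose g hg using fun t => cauchySeq_tendsto_of_complete (hca t)
  have hm : Monotone g := fun s t hst => le_of_tendsto_of_tendsto' (hg s) (hg t) fun n => (hh _).mono hst
  refine ⟨φ, hφ, g, ⟨?_, hm, ?_⟩, ⟨ge_of_tendsto' (hg 0) fun n => (h0 _).1, le_of_tendsto' (hg 0) fun n => (h0 _).2⟩, hg⟩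
  · rw [Metric.continuous_iff]
    intro t ε hε
    obtain ⟨d, hd, hde⟩ := heq (ε/2) (by positivity)
    refine ⟨d, hd, fun s hs => ?_⟩
    have := le_of_tendsto' ((hg (t+d)).sub (hg (t-d))) fun n => hde (φ n) t
    rw [Real.dist_eq, abs_lt] at *
    have a1 := hm (show t - d ≤ s by linarith)
    have a2 := hm (show s ≤ t + d by linarith)
    have a3 := hm (show t - d ≤ t by linarith)
    have a4 := hm (show t ≤ t + d by linarith)
    constructor <;> linarith
  · intro t
    refine tendsto_nhds_unique (hg (t+2*π)) ?_
    simp only [(hh _).per]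
    exact (hg t).add_const _

/-- modulus from bound tending to zero -/
lemma equi_of_log {h : ℕ → ℝ → ℝ} (hh : ∀ η > 0, ∃ B : ℝ, ∀ n c d, 0 < d → d ≤ 1/2 →
    (h n (c+d) - h n (c-d)) * Real.log (1/d) ≤ η * Real.log (1/d) + B) :
    ∀ ε > 0, ∃ d > 0, ∀ n c, h n (c+d) - h n (c-d) ≤ ε := by
  intro ε hε
  obtain ⟨B, hB⟩ := hh (ε/2) (by positivity)
  set L := max 1 (2*|B|/ε) with hL
  refine ⟨Real.exp (-L), Real.exp_pos _, fun n c => ?_⟩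
  have hd : Real.exp (-L) ≤ 1/2 := by
    have : Real.exp (-L) ≤ Real.exp (-1) := Real.exp_le_exp.2 (by linarith [le_max_left 1 (2*|B|/ε)])
    refine this.trans ?_
    rw [Real.exp_neg, one_div]
    apply inv_anti₀ two_pos
    have := Real.add_one_le_exp 1; linarith
  have := hB n c _ (Real.exp_pos _) hd
  rw [one_div, Real.log_inv, Real.log_exp, neg_neg] at this
  have hL0 : 0 < L := lt_of_lt_of_le one_pos (le_max_left _ _)
  have h2 : B ≤ ε/2 * L := by
    have : 2*|B|/ε ≤ L := le_max_right _ _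
    rw [div_le_iff₀ hε] at this
    linarith [le_abs_self B]
  by_contra hcon
  push Not at hcon
  nlinarith

end JW


namespace JW
open Real MeasureTheory Set Filter Topology

noncomputable def μ : Measure ℝ := volume.restrict (Ioc 0 (2*π))

instance : IsFiniteMeasure μ := by unfold μ; infer_instance

lemma integral_μ {E : Type*} [NormedAddCommGroup E] [NormedSpace ℝ E] (g : ℝ → E) :
    ∫ t, g t ∂μ = ∫ t in (0:ℝ)..2*π, g t := by
  rw [intervalIntegral.integral_of_le (by positivity)]; rfl

lemma integrable_μ_iff {E : Type*} [NormedAddCommGroup E] (g : ℝ → E) :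
    Integrable g μ ↔ IntervalIntegrable g volume 0 (2*π) := by
  rw [intervalIntegrable_iff_integrableOn_Ioc_of_le (by positivity)]; rfl

noncomputable def ker (x : ℝ) : ℝ := 1 / (4 * Real.sin (x/2)^2)

lemma ker_nonneg (x : ℝ) : 0 ≤ ker x := by unfold ker; positivity

lemma ker_meas : Measurable ker := by unfold ker; fun_prop

lemma ker_neg (x : ℝ) : ker (-x) = ker x := by
  unfold ker; rw [neg_div, Real.sin_neg, neg_sq]

lemma ker_per : Function.Periodic ker (2*π) := by
  intro x; unfold ker
  rw [show (x + 2*π)/2 = x/2 + π by ring, Real.sin_add_pi, neg_sq]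

noncomputable def Fe : ℕ → ℝ → ℝ
  | 0, _ => 0
  | 1, _ => 1
  | (n+2), x => 2 * Fe (n+1) x - Fe n x + 2 * Real.cos ((n+1) * x)

lemma Fe_cont : ∀ n, Continuous (Fe n) ∧ Continuous (Fe (n+1)) := by
  intro n
  induction n with
  | zero => exact ⟨continuous_const, continuous_const⟩
  | succ n ih =>
    refine ⟨ih.2, ?_⟩
    have h1 := ih.1
    have h2 := ih.2
    change Continuous fun x => 2 * Fe (n+1) x - Fe n x + 2 * Real.cos ((n+1) * x)
    fun_prop

lemma Fe_int : ∀ n : ℕ, (∫ x in (0:ℝ)..2*π, Fe n x = 2*π*n) ∧ (∫ x in (0:ℝ)..2*π, Fe (n+1) x = 2*π*(n+1)) := by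
  intro n
  induction n with
  | zero => constructor <;> simp [Fe]
  | succ n ih =>
    refine ⟨by rw [ih.2]; push_cast; ring, ?_⟩
    have h1 := (Fe_cont n).1
    have h2 := (Fe_cont n).2
    change ∫ x in (0:ℝ)..2*π, (2 * Fe (n+1) x - Fe n x + 2 * Real.cos ((n+1) * x)) = _
    rw [intervalIntegral.integral_add (Continuous.intervalIntegrable (by fun_prop) _ _)
       (Continuous.intervalIntegrable (by fun_prop) _ _),
       intervalIntegral.integral_sub (Continuous.intervalIntegrable (by fun_prop) _ _)
       (Continuous.intervalIntegrable (by fun_prop) _ _), intervalIntegral.integral_const_mul,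
       intervalIntegral.integral_const_mul, ih.1, ih.2]
    have : ∫ x in (0:ℝ)..2*π, Real.cos (((n:ℝ)+1) * x) = 0 := by
      rw [intervalIntegral.integral_comp_mul_left (fun x => Real.cos x) (by positivity)]
      rw [integral_cos]
      have := Real.sin_nat_mul_pi (2*(n+1))
      push_cast at this
      rw [show ((n:ℝ)+1)*(2*π) = 2*((n:ℝ)+1)*π by ring, this]; simp
    rw [this]; push_cast; ring

lemma Fe_eq (x : ℝ) : ∀ n : ℕ, (Fe n x * Real.sin (x/2)^2 = Real.sin (n*x/2)^2) ∧
    (Fe (n+1) x * Real.sin (x/2)^2 = Real.sin ((n+1)*x/2)^2) := by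
  intro n
  induction n with
  | zero => constructor <;> simp [Fe]
  | succ n ih =>
    refine ⟨by rw [ih.2]; push_cast; ring_nf, ?_⟩
    change (2 * Fe (n+1) x - Fe n x + 2 * Real.cos ((n+1) * x)) * _ = _
    have h1 := ih.1
    have h2 := ih.2
    have e0 : (n:ℝ)*x/2 = ((n:ℝ)+1)*x/2 - x/2 := by ring
    have e2 : (((n+1:ℕ):ℝ)+1)*x/2 = ((n:ℝ)+1)*x/2 + x/2 := by push_cast; ring
    have e1 : ((n:ℝ)+1)*x = 2*(((n:ℝ)+1)*x/2) := by ring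
    rw [e0, Real.sin_sub] at h1
    rw [e1, Real.cos_two_mul, e2, Real.sin_add]
    have s1 := Real.sin_sq_add_cos_sq (((n:ℝ)+1)*x/2)
    have s2 := Real.sin_sq_add_cos_sq (x/2)
    generalize Real.sin (((n:ℝ)+1)*x/2) = a at *
    generalize Real.cos (((n:ℝ)+1)*x/2) = b at *
    generalize Real.sin (x/2) = c at *
    generalize Real.cos (x/2) = d at *
    linear_combination 2*h2 - h1 + 2*c^2*s1 - 2*a^2*s2

lemma sin_half_pos {x : ℝ} (h : x ∈ Ioo 0 (2*π)) : 0 < Real.sin (x/2) :=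
  Real.sin_pos_of_pos_of_lt_pi (by linarith [h.1]) (by linarith [h.2])

lemma fejer (m : ℕ) : ∫ τ in (0:ℝ)..2*π, 4 * Real.sin (m*τ/2)^2 * ker τ = 2*π*m := by
  rw [← (Fe_int m).1]
  apply intervalIntegral.integral_congr_Ioo_of_le (by positivity)
  intro x hx
  have := sin_half_pos hx
  simp only [ker]
  rw [← ((Fe_eq x m).1)]
  field_simp

lemma fejer_integrable (m : ℕ) : Integrable (fun τ => 4 * Real.sin (m*τ/2)^2 * ker τ) μ := by
  have h : Integrable (Fe m) μ := (integrable_μ_iff _).2 ((Fe_cont m).1.intervalIntegrable _ _)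
  refine h.congr ?_
  unfold μ
  rw [restrict_Ioo_eq_restrict_Ioc.symm]
  refine (ae_restrict_iff' measurableSet_Ioo).2 (Eventually.of_forall fun x hx => ?_)
  have := sin_half_pos hx
  simp only [ker]
  rw [← ((Fe_eq x m).1)]
  field_simp

lemma shift {F : ℝ × ℝ → ℝ} (hF : Measurable F) (hp : ∀ s, Function.Periodic (fun t => F (s,t)) (2*π))
    (hi : Integrable F (μ.prod μ)) :
    Integrable (fun p : ℝ × ℝ => F (p.1, p.1 + p.2)) (μ.prod μ) ∧
    ∫ p, F p ∂(μ.prod μ) = ∫ τ, ∫ s, F (s, s+τ) ∂μ ∂μ := by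
  have hG : Measurable (fun p : ℝ × ℝ => F (p.1, p.1 + p.2)) := by fun_prop
  have hi2 : Integrable (fun p : ℝ × ℝ => F (p.1, p.1 + p.2)) (μ.prod μ) := by
    rw [integrable_prod_iff hF.aestronglyMeasurable] at hi
    rw [integrable_prod_iff hG.aestronglyMeasurable]
    constructor
    · filter_upwards [hi.1] with s hs
      rw [integrable_μ_iff] at hs ⊢
      have := (hp s).intervalIntegrable₀ (by positivity) hs s (s+2*π)
      have := this.comp_add_left (c := s)
      simpa using this
    · refine hi.2.congr (Eventually.of_forall fun s => ?_)
      simp only [integral_μ]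
      exact (periodic_shift (G := fun t => ‖F (s,t)‖) (fun t => by
        have := hp s t
        simp only at this ⊢
        rw [this]) s).symm
  refine ⟨hi2, ?_⟩
  rw [← integral_prod_symm _ hi2, integral_prod _ hi, integral_prod _ hi2]
  congr 1; ext s
  simp only [integral_μ]
  exact (periodic_shift (hp s) s).symm

end JW


namespace JW
open Real MeasureTheory Set Filter Topology

lemma Fc_diff {w : ℝ → ℝ} (hw : Continuous w) (hp : Function.Periodic w (2*π)) (τ : ℝ) (m : ℤ) :
    Fc (fun s => ((w s - w (s+τ) : ℝ) : ℂ)) m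
      = (1 - Complex.exp (-(Complex.I * m * τ))) * Fc (fun s => (w s : ℂ)) m := by
  have h := Fc_shift (g := fun s => (w s : ℂ)) (fun s => by simp only [hp s]) τ m
  have e : Fc (fun s => ((w s - w (s+τ) : ℝ) : ℂ)) m = Fc (fun s => (w s : ℂ)) m - Fc (fun s => (w (τ + s) : ℂ)) m := by
    unfold Fc
    rw [← intervalIntegral.integral_sub (Continuous.intervalIntegrable (by fun_prop) _ _)
      (Continuous.intervalIntegrable (by fun_prop) _ _)]
    congr 1; ext s; simp only [add_comm τ s]; push_cast; ring
  rw [e, h]; ring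

lemma exp_prod (m : ℕ) (τ : ℝ) : (1 - Complex.exp (Complex.I * (m:ℤ) * τ)) * (1 - Complex.exp (-(Complex.I * (m:ℤ) * τ)))
    = ((4 * Real.sin (m*τ/2)^2 : ℝ) : ℂ) := by
  have e : Complex.exp (Complex.I * (m:ℤ) * τ) = (Real.cos (m*τ) : ℂ) + (Real.sin (m*τ) : ℂ) * Complex.I := by
    rw [show Complex.I * (m:ℤ) * τ = ((m * τ : ℝ):ℂ) * Complex.I by push_cast; ring, Complex.exp_mul_I]
    push_cast; rfl
  have e' : Complex.exp (-(Complex.I * (m:ℤ) * τ)) = (Real.cos (m*τ) : ℂ) - (Real.sin (m*τ) : ℂ) * Complex.I := by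
    rw [show -(Complex.I * (m:ℤ) * τ) = ((-(m * τ) : ℝ):ℂ) * Complex.I by push_cast; ring, Complex.exp_mul_I,
      ← Complex.ofReal_cos, ← Complex.ofReal_sin, Real.cos_neg, Real.sin_neg]
    push_cast; ring
  have e2 : (4 * Real.sin (m*τ/2)^2 : ℝ) = 2 - 2 * Real.cos (m*τ) := by
    have := Real.cos_two_mul_eq_one_sub (m*τ/2)
    rw [show 2*((m:ℝ)*τ/2) = m*τ by ring] at this
    linarith
  rw [e, e', e2]
  have s1 := Real.sin_sq_add_cos_sq (m*τ)
  generalize Real.sin (m*τ) = a at *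
  generalize Real.cos (m*τ) = b at *
  have s2 : (a:ℂ)^2 + (b:ℂ)^2 = 1 := by exact_mod_cast s1
  push_cast
  linear_combination s2 - (a:ℂ)^2 * Complex.I_sq

lemma norm_sq_one_sub (m : ℕ) (τ : ℝ) : ‖1 - Complex.exp (-(Complex.I * (m:ℤ) * τ))‖^2 = 4 * Real.sin (m*τ/2)^2 := by
  have h := exp_prod m τ
  have hc : (1 - Complex.exp (Complex.I * (m:ℤ) * τ)) = (starRingEnd ℂ) (1 - Complex.exp (-(Complex.I * (m:ℤ) * τ))) := by
    rw [map_sub, map_one, ← Complex.exp_conj]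
    congr 2
    simp [Complex.conj_ofReal]
  rw [hc, mul_comm, Complex.mul_conj] at h
  rw [← Complex.normSq_eq_norm_sq]
  exact_mod_cast h

lemma bessel_slice {g : ℝ → ℝ} (hg : Continuous g) (N : ℕ) :
    ∑ k ∈ Finset.range N, ‖Fc (fun s => (g s : ℂ)) ((k+1:ℕ):ℤ)‖^2 ≤ 2*π * ∫ s in (0:ℝ)..2*π, g s ^2 := by
  have hab : (0:ℝ) < 2*π := by positivity
  have hL2 : MemLp (fun s => (g s : ℂ)) 2 (volume.restrict (Ioc 0 (2*π))) := by
    obtain ⟨M, hM⟩ : ∃ M, ∀ x ∈ Icc 0 (2*π), ‖g x‖ ≤ M :=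
      isCompact_Icc.exists_bound_of_continuousOn hg.continuousOn
    refine MemLp.of_bound (by apply Continuous.aestronglyMeasurable; fun_prop) M ?_
    refine (ae_restrict_iff' measurableSet_Ioc).2 (Eventually.of_forall fun x hx => ?_)
    rw [Complex.norm_real]; exact hM x ⟨hx.1.le, hx.2⟩
  have H := hasSum_sq_fourierCoeffOn hab hL2
  have hco : ∀ k : ℕ, ‖fourierCoeffOn hab (fun s => (g s : ℂ)) (-((k+1:ℕ):ℤ))‖^2 = (1/(2*π))^2 * ‖Fc (fun s => (g s : ℂ)) ((k+1:ℕ):ℤ)‖^2 := by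
    intro k
    rw [fourierCoeffOn_eq_integral, norm_smul, mul_pow, sub_zero, neg_neg, Real.norm_eq_abs, abs_of_nonneg (by positivity)]
    congr 3
    unfold Fc
    congr 1; ext s
    rw [fourier_coe_apply, smul_eq_mul, mul_comm]
    congr 2
    push_cast
    have : (π:ℂ) ≠ 0 := by exact_mod_cast Real.pi_ne_zero
    field_simp
    try ring
  have hinj : Function.Injective fun k : ℕ => (-((k+1:ℕ):ℤ)) := by intro a b h; simp at h; exact h
  have h2 := H.summable.comp_injective hinj
  have h3 : ∑ k ∈ Finset.range N, ‖fourierCoeffOn hab (fun s => (g s : ℂ)) (-((k+1:ℕ):ℤ))‖^2 ≤ (2*π - 0)⁻¹ • ∫ x in (0:ℝ)..2*π, ‖(g x : ℂ)‖^2 := by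
    rw [← Finset.sum_image (f := fun i => ‖fourierCoeffOn hab (fun s => (g s : ℂ)) i‖^2) (s := Finset.range N) (fun a _ b _ h => hinj h)]
    exact sum_le_hasSum _ (fun _ _ => by positivity) H
  simp only [hco, ← Finset.mul_sum, Complex.norm_real, Real.norm_eq_abs, sq_abs, smul_eq_mul, sub_zero] at h3
  have hp : 0 < π := Real.pi_pos
  calc _ = (2*π)^2 * ((1/(2*π))^2 * ∑ k ∈ Finset.range N, ‖Fc (fun s => (g s : ℂ)) ((k+1:ℕ):ℤ)‖^2) := by field_simp
    _ ≤ (2*π)^2 * ((2*π)⁻¹ * ∫ s in (0:ℝ)..2*π, g s ^2) := by gcongr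
    _ = _ := by field_simp

noncomputable def en (w : ℝ → ℝ) (p : ℝ × ℝ) : ℝ := (w p.1 - w p.2)^2 * ker (p.1 - p.2)

lemma ker_sub_per (s : ℝ) : Function.Periodic (fun t => ker (s - t)) (2*π) := by
  intro t
  simp only
  rw [← ker_per (s - (t + 2*π))]; congr 1; ring

lemma bessel {w : ℝ → ℝ} (hw : Continuous w) (hp : Function.Periodic w (2*π))
    (hi : Integrable (en w) (μ.prod μ)) (N : ℕ) :
    ∑ k ∈ Finset.range N, ((k:ℝ)+1) * ‖Fc (fun s => (w s : ℂ)) ((k+1:ℕ):ℤ)‖^2 ≤ ∫ p, en w p ∂(μ.prod μ) := by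
  have hk := ker_meas
  obtain ⟨h1, h2⟩ := shift (F := en w) (by unfold en; fun_prop) (fun s t => by
    have := ker_sub_per s t
    simp only at this
    simp only [en, hp t, this]) hi
  rw [h2]
  have hsl : ∀ τ, ∫ s, en w (s, s+τ) ∂μ = (∫ s in (0:ℝ)..2*π, (w s - w (s+τ))^2) * ker τ := by
    intro τ
    rw [integral_μ, ← intervalIntegral.integral_mul_const]
    congr 1; ext s
    simp only [en]
    rw [show s - (s+τ) = -τ by ring, ker_neg]
  have hint : Integrable (fun τ => ∫ s, en w (s, s+τ) ∂μ) μ := h1.integral_prod_right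
  have hle : ∀ τ, (∑ k ∈ Finset.range N, (‖Fc (fun s => (w s : ℂ)) ((k+1:ℕ):ℤ)‖^2/(2*π)) * (4 * Real.sin (((k+1:ℕ):ℝ)*τ/2)^2 * ker τ))
      ≤ ∫ s, en w (s, s+τ) ∂μ := by
    intro τ
    rw [hsl]
    have := bessel_slice (g := fun s => w s - w (s+τ)) (by fun_prop) N
    simp only [Fc_diff hw hp, norm_mul, mul_pow, norm_sq_one_sub] at this
    have hpi := Real.pi_pos
    calc _ = (∑ k ∈ Finset.range N, (4 * Real.sin (((k+1:ℕ):ℝ)*τ/2)^2 * ‖Fc (fun s => (w s : ℂ)) ((k+1:ℕ):ℤ)‖^2))/(2*π) * ker τ := by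
          rw [Finset.sum_div, Finset.sum_mul]; congr 1; ext k; ring
      _ ≤ (2*π * ∫ s in (0:ℝ)..2*π, (w s - w (s+τ))^2)/(2*π) * ker τ := by
          have := ker_nonneg τ
          gcongr
      _ = _ := by field_simp
  have hI := integral_mono (μ := μ) (integrable_finsetSum _ fun k _ => (fejer_integrable (k+1)).const_mul _) hint hle
  rw [integral_finsetSum _ (fun k _ => (fejer_integrable (k+1)).const_mul _)] at hI
  simp only [integral_const_mul, integral_μ, fejer] at hI
  simp only [integral_μ]
  refine le_trans (le_of_eq ?_) hI
  congr 1; ext k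
  have hpi := Real.pi_pos
  push_cast
  field_simp

/-- test variation -/
noncomputable def X (c : ℂ) (m : ℕ) (t : ℝ) : ℝ := (c * (Complex.exp (Complex.I * (m:ℤ) * t) - 1)).re

lemma X_cont (c : ℂ) (m : ℕ) : Continuous (X c m) := by unfold X; fun_prop

lemma X_per (c : ℂ) (m : ℕ) : Function.Periodic (X c m) (2*π) := by
  intro t
  have := exp_periodic (m:ℤ) t
  simp only at this
  simp only [X, this]

lemma pair_slice {w : ℝ → ℝ} (hw : Continuous w) (hp : Function.Periodic w (2*π)) (c : ℂ) (m : ℕ) (τ : ℝ) :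
    ∫ s in (0:ℝ)..2*π, (w s - w (s+τ)) * (X c m s - X c m (s+τ)) = 4 * Real.sin (m*τ/2)^2 * (c * Fc (fun s => (w s : ℂ)) m).re := by
  have h := Fc_diff hw hp τ m
  have h2 : c * ((1 - Complex.exp (Complex.I * (m:ℤ) * τ)) * Fc (fun s => ((w s - w (s+τ) : ℝ) : ℂ)) m)
      = ((4 * Real.sin (m*τ/2)^2 : ℝ) : ℂ) * (c * Fc (fun s => (w s : ℂ)) m) := by
    rw [h, ← exp_prod m τ]; ring
  have h3 := congrArg Complex.re h2
  rw [Complex.re_ofReal_mul] at h3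
  rw [← h3]
  unfold Fc
  rw [← intervalIntegral.integral_const_mul, ← intervalIntegral.integral_const_mul, ← Complex.reCLM_apply,
    ← ContinuousLinearMap.intervalIntegral_comp_comm _ (Continuous.intervalIntegrable (by fun_prop) _ _)]
  congr 1; ext s
  rw [Complex.reCLM_apply]
  unfold X
  rw [← Complex.sub_re, ← Complex.re_ofReal_mul]
  congr 1
  have : Complex.exp (Complex.I * (m:ℤ) * ((s+τ:ℝ):ℂ)) = Complex.exp (Complex.I * (m:ℤ) * s) * Complex.exp (Complex.I * (m:ℤ) * τ) := by
    rw [← Complex.exp_add]; push_cast; ring_nf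
  rw [this]; push_cast; ring

lemma pair_X {w : ℝ → ℝ} (hw : Continuous w) (hp : Function.Periodic w (2*π)) (c : ℂ) (m : ℕ)
    (hi : Integrable (fun p : ℝ × ℝ => (w p.1 - w p.2) * (X c m p.1 - X c m p.2) * ker (p.1 - p.2)) (μ.prod μ)) :
    ∫ p : ℝ × ℝ, (w p.1 - w p.2) * (X c m p.1 - X c m p.2) * ker (p.1 - p.2) ∂(μ.prod μ) = 2*π*m * (c * Fc (fun s => (w s : ℂ)) m).re := by
  have hk := ker_meas
  have hX := X_cont c m
  obtain ⟨h1, h2⟩ := shift (F := fun p : ℝ × ℝ => (w p.1 - w p.2) * (X c m p.1 - X c m p.2) * ker (p.1 - p.2)) (by fun_prop) (fun s t => by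
    have := ker_sub_per s t
    simp only at this
    simp only [hp t, this, X_per c m t]) hi
  rw [h2]
  have hsl : ∀ τ, ∫ s, (w s - w (s+τ)) * (X c m s - X c m (s+τ)) * ker (s - (s+τ)) ∂μ =
      (4 * Real.sin (m*τ/2)^2 * ker τ) * (c * Fc (fun s => (w s : ℂ)) m).re := by
    intro τ
    rw [show ∀ τ : ℝ, (4 * Real.sin (m*τ/2)^2 * ker τ) * (c * Fc (fun s => (w s : ℂ)) m).re = (4 * Real.sin (m*τ/2)^2 *  (c * Fc (fun s => (w s : ℂ)) m).re) * ker τ by intro τ; ring]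
    rw [← pair_slice hw hp, integral_μ, ← intervalIntegral.integral_mul_const]
    congr 1; ext s
    rw [show s - (s+τ) = -τ by ring, ker_neg]
  simp only [hsl]
  rw [integral_mul_const, integral_μ, fejer]

end JW


namespace JW
open Real MeasureTheory Set Filter Topology

lemma abs_sin_nat_mul (n : ℕ) (x : ℝ) : |Real.sin (n*x)| ≤ n * |Real.sin x| := by
  induction n with
  | zero => simp
  | succ n ih =>
    push_cast
    rw [add_mul, one_mul, Real.sin_add]
    have h1 : |Real.sin (n*x) * Real.cos x| ≤ |Real.sin (n*x)| := by
      rw [abs_mul]; exact mul_le_of_le_one_right (abs_nonneg _) (Real.abs_cos_le_one _)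
    have h2 : |Real.cos (n*x) * Real.sin x| ≤ |Real.sin x| := by
      rw [abs_mul]; exact mul_le_of_le_one_left (abs_nonneg _) (Real.abs_cos_le_one _)
    have := abs_add_le (Real.sin (n*x) * Real.cos x) (Real.cos (n*x) * Real.sin x)
    linarith

lemma X_diff {c : ℂ} (hc : ‖c‖ ≤ 1) (m : ℕ) (s t : ℝ) : |X c m s - X c m t| ≤ 2*m*|Real.sin ((s-t)/2)| := by
  unfold X
  rw [← Complex.sub_re]
  refine (Complex.abs_re_le_norm _).trans ?_
  have e : c * (Complex.exp (Complex.I * (m:ℤ) * s) - 1) - c * (Complex.exp (Complex.I * (m:ℤ) * t) - 1)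
     = c * (Complex.exp (Complex.I * (m:ℤ) * s) * (1 - Complex.exp (-(Complex.I * (m:ℤ) * ((s-t:ℝ):ℂ))))) := by
    rw [mul_sub (Complex.exp _), ← Complex.exp_add]
    rw [show Complex.I * (m:ℤ) * s + -(Complex.I * (m:ℤ) * ((s-t:ℝ):ℂ)) = Complex.I * (m:ℤ) * t by push_cast; ring]
    ring
  rw [e, norm_mul, norm_mul, norm_exp_I, one_mul]
  have h2 : ‖1 - Complex.exp (-(Complex.I * (m:ℤ) * ((s-t:ℝ):ℂ)))‖ ≤ 2*m*|Real.sin ((s-t)/2)| := by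
    apply le_of_sq_le_sq _ (by positivity)
    rw [norm_sq_one_sub]
    have := abs_sin_nat_mul m ((s-t)/2)
    rw [show (m:ℝ) * ((s-t)/2) = m * (s-t)/2 by ring] at this
    have := pow_le_pow_left₀ (abs_nonneg _) this 2
    rw [sq_abs] at this
    nlinarith
  calc _ ≤ 1 * ‖1 - Complex.exp (-(Complex.I * (m:ℤ) * ((s-t:ℝ):ℂ)))‖ := by gcongr
    _ ≤ _ := by rw [one_mul]; exact h2

noncomputable def Xd (c : ℂ) (m : ℕ) (t : ℝ) : ℝ := (c * (Complex.I * (m:ℤ) * Complex.exp (Complex.I * (m:ℤ) * t))).re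

lemma Xd_cont (c : ℂ) (m : ℕ) : Continuous (Xd c m) := by unfold Xd; fun_prop

lemma Xd_per (c : ℂ) (m : ℕ) : Function.Periodic (Xd c m) (2*π) := by
  intro t
  have := exp_periodic (m:ℤ) t
  simp only at this
  simp only [Xd, this]

lemma Xd_bound {c : ℂ} (hc : ‖c‖ ≤ 1) (m : ℕ) (t : ℝ) : |Xd c m t| ≤ 2*m := by
  unfold Xd
  refine (Complex.abs_re_le_norm _).trans ?_
  rw [norm_mul, norm_mul, norm_mul, norm_exp_I, Complex.norm_I]
  have : ‖((m:ℤ):ℂ)‖ = m := by simp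
  rw [this]
  have : (0:ℝ) ≤ m := by positivity
  nlinarith

lemma X_deriv (c : ℂ) (m : ℕ) (t : ℝ) : HasDerivAt (X c m) (Xd c m t) t := by
  have h1 : HasDerivAt (fun t : ℂ => c * (Complex.exp (Complex.I * (m:ℤ) * t) - 1))
      (c * (Complex.I * (m:ℤ) * Complex.exp (Complex.I * (m:ℤ) * t))) (t:ℂ) := by
    have := (((hasDerivAt_id (t:ℂ)).const_mul (Complex.I * (m:ℤ))).cexp.sub_const 1).const_mul c
    exact this.congr_deriv (by simp [mul_comm])
  exact h1.real_of_complex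

noncomputable def kap (c : ℂ) (m : ℕ) (s t : ℝ) : ℝ :=
  Xd c m s + Xd c m t - (X c m s - X c m t) * (Real.cos ((s-t)/2) / Real.sin ((s-t)/2))

lemma y_bound {c : ℂ} (hc : ‖c‖ ≤ 1) (m : ℕ) (s t : ℝ) :
   |(X c m s - X c m t) * (Real.cos ((s-t)/2) / Real.sin ((s-t)/2))| ≤ 2*m := by
  by_cases hS : Real.sin ((s-t)/2) = 0
  · rw [hS]; simp
  have hS' : 0 < |Real.sin ((s-t)/2)| := abs_pos.2 hS
  rw [abs_mul, abs_div, ← mul_div_assoc, div_le_iff₀ hS']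
  have h1 := X_diff hc m s t
  have h2 := Real.abs_cos_le_one ((s-t)/2)
  calc _ ≤ |X c m s - X c m t| * 1 := by gcongr
    _ ≤ _ := by linarith

lemma kap_bound {c : ℂ} (hc : ‖c‖ ≤ 1) (m : ℕ) (s t : ℝ) : |kap c m s t| ≤ 6*m := by
  unfold kap
  have h1 := abs_le.1 (Xd_bound hc m s)
  have h2 := abs_le.1 (Xd_bound hc m t)
  have h3 := abs_le.1 (y_bound hc m s t)
  rw [abs_le]; constructor <;> linarith

lemma poly_ineq {α β γ e R : ℝ} (he0 : 0 ≤ e) (he : e ≤ 1/10) (ha : |α| ≤ e) (hb : |β| ≤ e) (hg : |γ| ≤ e)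
    (hR : 1 + γ/2 - e^2 ≤ R) : (1+α)*(1+β) ≤ (1+α+β-γ+10*e^2) * R^2 := by
  rw [abs_le] at *
  have hq : 0 ≤ 1 + γ/2 - e^2 := by nlinarith
  have h1 : (1 + γ/2 - e^2)^2 ≤ R^2 := pow_le_pow_left₀ hq hR 2
  have h2 : 1 + γ - 2.1*e^2 ≤ R^2 := by
    nlinarith [mul_nonneg (sub_nonneg.2 hg.2) (sq_nonneg e), sq_nonneg γ, sq_nonneg (e^2), mul_nonneg (sub_nonneg.2 he) (sq_nonneg e)]
  have h3 : 0 ≤ 1+α+β-γ+10*e^2 := by nlinarith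
  refine le_trans ?_ (mul_le_mul_of_nonneg_left h2 h3)
  have k1 : α*β ≤ e^2 := by nlinarith
  have k2 : -(3*e^2) ≤ (α+β-γ)*γ := by nlinarith
  have k3 : (α+β-γ) ≤ 3/10 := by linarith
  have k4 : -(1/10) ≤ γ := by linarith
  have k5 : e^2 ≤ 1/100 := by nlinarith
  nlinarith [mul_le_mul_of_nonneg_right k3 (sq_nonneg e), mul_le_mul_of_nonneg_right k4 (sq_nonneg e),
    mul_le_mul_of_nonneg_right k5 (sq_nonneg e)]

lemma sin_sub_self {x : ℝ} (hx : |x| ≤ 1) : |Real.sin x - x| ≤ x^2 := by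
  have h := Real.sin_bound hx
  have h3 : |x|^5 ≤ x^2 := by
    rw [← sq_abs x]
    exact pow_le_pow_of_le_one (abs_nonneg x) hx (by norm_num)
  have h4 : |x^3| ≤ x^2 := by
    rw [abs_pow, ← sq_abs x]
    nlinarith [abs_nonneg x, sq_nonneg (|x|), mul_nonneg (sq_nonneg (|x|)) (sub_nonneg.2 hx)]
  rw [abs_le] at h h4 ⊢
  constructor <;> nlinarith [sq_nonneg x]

set_option maxHeartbeats 1000000 in
lemma weight {c : ℂ} (hc : ‖c‖ ≤ 1) (m : ℕ) {ε : ℝ} (hε : 2*m*|ε| ≤ 1/10) (s t : ℝ)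
    (hS : Real.sin ((s-t)/2) ≠ 0) :
    ker ((s + ε * X c m s) - (t + ε * X c m t)) * ((1 + ε * Xd c m s) * (1 + ε * Xd c m t)) ≤
      ker (s-t) * (1 + ε * kap c m s t + 10 * (2*m*|ε|)^2) := by
  set e := 2*m*|ε| with he
  have he0 : 0 ≤ e := by positivity
  set S := Real.sin ((s-t)/2) with hSd
  set C := Real.cos ((s-t)/2) with hCd
  set Δ := X c m s - X c m t with hΔ
  have hXd : |Δ| ≤ 2*m*|S| := X_diff hc m s t
  have hS' : 0 < |S| := abs_pos.2 hS
  have hS1 : |S| ≤ 1 := Real.abs_sin_le_one _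
  set x := ε*Δ/2 with hx
  have hxb : |x| ≤ e*|S|/2 := by
    rw [hx, abs_div, abs_mul, abs_two, he]
    have := mul_le_mul_of_nonneg_left hXd (abs_nonneg ε)
    linarith
  have hx1 : |x| ≤ 1 := by nlinarith
  have hx2 : x^2 ≤ e^2*S^2/4 := by
    have := pow_le_pow_left₀ (abs_nonneg x) hxb 2
    calc x^2 = |x|^2 := (sq_abs x).symm
      _ ≤ _ := this
      _ = e^2*|S|^2/4 := by ring
      _ = _ := by rw [sq_abs]
  set R := Real.cos x + C/S * Real.sin x with hR
  have hsin : Real.sin (((s + ε * X c m s) - (t + ε * X c m t))/2) = S * R := by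
    rw [show ((s + ε * X c m s) - (t + ε * X c m t))/2 = (s-t)/2 + x by rw [hx, hΔ]; ring, Real.sin_add, hR,
      ← hSd, ← hCd]
    field_simp
  have hγ : |ε * (Δ * (C/S))| ≤ e := by
    rw [abs_mul, he]
    have := mul_le_mul_of_nonneg_left (y_bound hc m s t) (abs_nonneg ε)
    linarith
  have hRb : 1 + ε * (Δ * (C/S))/2 - e^2 ≤ R := by
    have h1 := Real.one_sub_sq_div_two_le_cos (x := x)
    have h2 : |C/S * (Real.sin x - x)| ≤ e^2/4 := by
      rw [abs_mul, abs_div, div_mul_eq_mul_div, div_le_iff₀ hS']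
      have h3 := sin_sub_self hx1
      have h4 : |C| ≤ 1 := Real.abs_cos_le_one _
      calc |C| * |Real.sin x - x| ≤ 1 * (e^2*S^2/4) := by
            apply mul_le_mul h4 (h3.trans hx2) (abs_nonneg _) zero_le_one
        _ = e^2/4 * (|S| * |S|) := by rw [← sq, sq_abs]; ring
        _ ≤ e^2/4 * (|S| * 1) := by gcongr
        _ = _ := by ring
    have h5 := (abs_le.1 h2).1
    have h6 : ε * (Δ * (C/S))/2 = C/S * x := by rw [hx]; ring
    have hS2 : S^2 ≤ 1 := by rw [← sq_abs]; exact pow_le_one₀ (abs_nonneg _) hS1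
    have h7 : x^2 ≤ e^2/4 := by nlinarith [sq_nonneg e]
    rw [h6, hR]
    nlinarith
  have ha : |ε * Xd c m s| ≤ e := by
    rw [abs_mul, he]; have := mul_le_mul_of_nonneg_left (Xd_bound hc m s) (abs_nonneg ε); linarith
  have hb : |ε * Xd c m t| ≤ e := by
    rw [abs_mul, he]; have := mul_le_mul_of_nonneg_left (Xd_bound hc m t) (abs_nonneg ε); linarith
  have key := poly_ineq he0 hε ha hb hγ hRb
  have hRpos : 0 < R := by
    have := (abs_le.1 hγ).1
    nlinarith
  unfold ker
  rw [hsin, ← hSd, mul_pow, div_mul_eq_mul_div, div_mul_eq_mul_div, one_mul, one_mul]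
  have hS2 : 0 < S^2 := by positivity
  rw [div_le_div_iff₀ (by positivity) (by positivity)]
  have hk : 1 + ε * kap c m s t + 10*e^2 = 1 + ε * Xd c m s + ε * Xd c m t - ε * (Δ * (C/S)) + 10*e^2 := by
    unfold kap; rw [← hSd, ← hCd, ← hΔ]; ring
  rw [hk]
  nlinarith [mul_le_mul_of_nonneg_right key (show 0 ≤ 4*S^2 by positivity)]

/-- the polynomial kernel -/
noncomputable def Sm (m : ℕ) (z w : ℂ) : ℂ := ∑ p ∈ Finset.HasAntidiagonal.antidiagonal m, ((p.1:ℂ) * p.2) * (z^p.1 * w^p.2)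
noncomputable def Tm (m : ℕ) (z w : ℂ) : ℂ := ∑ p ∈ Finset.HasAntidiagonal.antidiagonal m, (p.1:ℂ) * (z^p.1 * w^p.2)

lemma Tm_succ (m : ℕ) (z w : ℂ) : Tm (m+1) z w = w * Tm m z w + (m+1) * z^(m+1) := by
  unfold Tm
  rw [Finset.Nat.antidiagonal_succ', Finset.sum_cons, Finset.sum_map, Finset.mul_sum, add_comm]
  congr 1
  · apply Finset.sum_congr rfl; intro p _; simp; ring
  · simp

lemma Sm_succ (m : ℕ) (z w : ℂ) : Sm (m+1) z w = w * Sm m z w + w * Tm m z w := by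
  unfold Tm Sm
  rw [Finset.Nat.antidiagonal_succ', Finset.sum_cons, Finset.sum_map, Finset.mul_sum, Finset.mul_sum, ← Finset.sum_add_distrib]
  simp only [Nat.cast_zero, mul_zero, zero_mul, zero_add]
  apply Finset.sum_congr rfl; intro p _; simp; ring

lemma Tm_eq (m : ℕ) (z w : ℂ) : (z-w)^2 * Tm m z w = m * z^(m+2) - (m+1) * z^(m+1) * w + z * w^(m+1) := by
  induction m with
  | zero => simp [Tm]
  | succ m ih => rw [Tm_succ]; push_cast; linear_combination w * ih

lemma Sm_eq (m : ℕ) (z w : ℂ) : (z-w)^3 * Sm m z w = z*w*(m*(z^m+w^m)*(z-w) - (z+w)*(z^m-w^m)) := by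
  induction m with
  | zero => simp [Sm]
  | succ m ih =>
    rw [Sm_succ]; push_cast
    linear_combination w * ih + (z-w) * w * Tm_eq m z w

lemma kernel_id (c : ℂ) (m : ℕ) (s t : ℝ) (hS : Real.sin ((s-t)/2) ≠ 0) :
    ker (s-t) * kap c m s t = (-Complex.I * c * Sm m (Complex.exp (Complex.I * s)) (Complex.exp (Complex.I * t))).re := by
  set z := Complex.exp (Complex.I * s) with hz
  set w := Complex.exp (Complex.I * t) with hw
  set E := Complex.exp (Complex.I * ((s+t)/2 : ℝ)) with hE
  set S := Real.sin ((s-t)/2) with hSd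
  set C := Real.cos ((s-t)/2) with hCd
  have hE0 : E ≠ 0 := Complex.exp_ne_zero _
  have e1 : Complex.exp (Complex.I * ((s-t)/2 : ℝ)) = (C:ℂ) + (S:ℂ) * Complex.I := by
    rw [mul_comm, Complex.exp_mul_I, hCd, hSd, ← Complex.ofReal_cos, ← Complex.ofReal_sin]
  have e2 : Complex.exp (-(Complex.I * ((s-t)/2 : ℝ))) = (C:ℂ) - (S:ℂ) * Complex.I := by
    rw [show -(Complex.I * (((s-t)/2 : ℝ):ℂ)) = ((-((s-t)/2) : ℝ):ℂ) * Complex.I by push_cast; ring, Complex.exp_mul_I, hCd, hSd,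
      ← Complex.ofReal_cos, ← Complex.ofReal_sin, Real.cos_neg, Real.sin_neg]
    push_cast; ring
  have ez : z = E * (C + S * Complex.I) := by
    rw [← e1, hE, ← Complex.exp_add, hz]; congr 1; push_cast; ring
  have ew : w = E * (C - S * Complex.I) := by
    rw [← e2, hE, ← Complex.exp_add, hw]; congr 1; push_cast; ring
  have hSC : (S:ℂ) ≠ 0 := by exact_mod_cast hS
  have hCS : (S:ℂ)^2 + (C:ℂ)^2 = 1 := by
    have := Real.sin_sq_add_cos_sq ((s-t)/2); rw [← hSd, ← hCd] at this; exact_mod_cast this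
  have hzw : z - w = 2 * E * S * Complex.I := by rw [ez, ew]; ring
  have hzw2 : z + w = 2 * E * C := by rw [ez, ew]; ring
  have hpr : z * w = E^2 := by rw [ez, ew]; linear_combination E^2 * hCS - E^2 * S^2 * Complex.I_sq
  have hpz : ∀ x : ℝ, Complex.exp (Complex.I * (m:ℤ) * x) = Complex.exp (Complex.I * x)^m := by
    intro x; rw [← Complex.exp_nat_mul]; congr 1; push_cast; ring
  have key : -Complex.I * c * Sm m z w = ((1/(4*S^2) : ℝ):ℂ) * (c * (Complex.I * (m:ℤ) * z^m) + c * (Complex.I * (m:ℤ) * w^m)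
      - ((C/S : ℝ) : ℂ) * (c * (z^m - 1) - c * (w^m - 1))) := by
    have h := Sm_eq m z w
    rw [hzw, hzw2, hpr] at h
    have hI3 : Complex.I^3 = -Complex.I := by rw [pow_succ, Complex.I_sq]; ring
    have h' : 8 * (E^3 * S^3) * (-Complex.I * Sm m z w) = (E^3 * S^3) * (2 / S^2 *(m * (z^m+w^m) * Complex.I - C/S * (z^m-w^m))) := by
      have : 8 * (E^3 * S^3) * (-Complex.I * Sm m z w) = (2*E*S*Complex.I)^3 * Sm m z w := by
        rw [mul_pow, hI3]; ring
      rw [this, h]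
      field_simp
    have h4 : -Complex.I * Sm m z w = 1/(4*S^2) * (m * (z^m+w^m) * Complex.I - C/S * (z^m-w^m)) := by
      have hne : 8 * (E^3 * (S:ℂ)^3) ≠ 0 := by simp [hE0, hSC]
      apply mul_left_cancel₀ hne
      rw [h']; field_simp; ring
    push_cast
    linear_combination c * h4
  rw [key, Complex.re_ofReal_mul, Complex.sub_re, Complex.re_ofReal_mul, Complex.add_re, Complex.sub_re, hz, hw, ← hpz, ← hpz]
  unfold ker kap Xd X
  rw [← hSd, ← hCd]
  ring

end JW


namespace JW
open Real MeasureTheory Set Filter Topology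

lemma cont_int {E : Type*} [NormedAddCommGroup E] {F : ℝ × ℝ → E} (hF : Continuous F) :
    Integrable F (μ.prod μ) := by
  unfold μ
  rw [Measure.prod_restrict, ← Measure.volume_eq_prod]
  exact (hF.continuousOn.integrableOn_compact (isCompact_Icc.prod isCompact_Icc)).mono_set
    (Set.prod_mono Ioc_subset_Icc_self Ioc_subset_Icc_self)

lemma Fc_eq_μ (g : ℝ → ℂ) (m : ℕ) : ∫ t, g t * Complex.exp (Complex.I * t)^m ∂μ = Fc g m := by
  rw [integral_μ]; unfold Fc
  congr 1; ext t
  rw [← Complex.exp_nat_mul]; congr 2; push_cast; ring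

lemma quad_term {g : ℝ → ℝ} (hg : Continuous g) (a b : ℕ) :
    ∫ p : ℝ × ℝ, (((g p.1 - g p.2)^2 : ℝ) : ℂ) * (Complex.exp (Complex.I * p.1)^(a+1) * Complex.exp (Complex.I * p.2)^(b+1)) ∂(μ.prod μ)
     = -2 * (Fc (fun s => (g s : ℂ)) (a+1:ℕ) * Fc (fun s => (g s : ℂ)) (b+1:ℕ)) := by
  have e : ∀ p : ℝ × ℝ, (((g p.1 - g p.2)^2 : ℝ) : ℂ) * (Complex.exp (Complex.I * p.1)^(a+1) * Complex.exp (Complex.I * p.2)^(b+1))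
      = ((g p.1 : ℂ)^2 * Complex.exp (Complex.I * p.1)^(a+1)) * (1 * Complex.exp (Complex.I * p.2)^(b+1))
       + (1 * Complex.exp (Complex.I * p.1)^(a+1)) * ((g p.2 : ℂ)^2 * Complex.exp (Complex.I * p.2)^(b+1))
       - 2 * (((g p.1 : ℂ) * Complex.exp (Complex.I * p.1)^(a+1)) * ((g p.2 : ℂ) * Complex.exp (Complex.I * p.2)^(b+1))) := by
    intro p; push_cast; ring
  simp only [e]
  rw [integral_sub (cont_int (by fun_prop)) (cont_int (by fun_prop)),
    integral_add (cont_int (by fun_prop)) (cont_int (by fun_prop)), integral_const_mul]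
  rw [integral_prod_mul (fun s : ℝ => ((g s : ℂ)^2 * Complex.exp (Complex.I * s)^(a+1))) (fun s : ℝ => (1 * Complex.exp (Complex.I * s)^(b+1))),
    integral_prod_mul (fun s : ℝ => (1 * Complex.exp (Complex.I * s)^(a+1))) (fun s : ℝ => ((g s : ℂ)^2 * Complex.exp (Complex.I * s)^(b+1))),
    integral_prod_mul (fun s : ℝ => ((g s : ℂ) * Complex.exp (Complex.I * s)^(a+1))) (fun s : ℝ => ((g s : ℂ) * Complex.exp (Complex.I * s)^(b+1)))]
  have h1 := Fc_eq_μ (fun _ => 1) (a+1)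
  have h2 := Fc_eq_μ (fun _ => 1) (b+1)
  rw [Fc_one] at h1 h2
  rw [h1, h2, Fc_eq_μ (fun s => (g s : ℂ)), Fc_eq_μ (fun s => (g s : ℂ))]
  ring

lemma quad {g : ℝ → ℝ} (hg : Continuous g) (c : ℂ) (m : ℕ) :
    ∫ p : ℝ × ℝ, (g p.1 - g p.2)^2 * (-Complex.I * c * Sm m (Complex.exp (Complex.I * p.1)) (Complex.exp (Complex.I * p.2))).re ∂(μ.prod μ)
     = (2 * Complex.I * c * ∑ p ∈ Finset.HasAntidiagonal.antidiagonal m, ((p.1:ℂ) * p.2) * (Fc (fun s => (g s : ℂ)) p.1 * Fc (fun s => (g s : ℂ)) p.2)).re := by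
  have hSm : Continuous fun p : ℝ × ℝ => Sm m (Complex.exp (Complex.I * p.1)) (Complex.exp (Complex.I * p.2)) := by
    unfold Sm; fun_prop
  have h1 : ∫ p : ℝ × ℝ, (((g p.1 - g p.2)^2 : ℝ) : ℂ) * (-Complex.I * c * Sm m (Complex.exp (Complex.I * p.1)) (Complex.exp (Complex.I * p.2))) ∂(μ.prod μ)
      = 2 * Complex.I * c * ∑ p ∈ Finset.HasAntidiagonal.antidiagonal m, ((p.1:ℂ) * p.2) * (Fc (fun s => (g s : ℂ)) p.1 * Fc (fun s => (g s : ℂ)) p.2) := by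
    have e : ∀ p : ℝ × ℝ, (((g p.1 - g p.2)^2 : ℝ) : ℂ) * (-Complex.I * c * Sm m (Complex.exp (Complex.I * p.1)) (Complex.exp (Complex.I * p.2)))
       = (-Complex.I * c) * ∑ q ∈ Finset.HasAntidiagonal.antidiagonal m, ((q.1:ℂ) * q.2) * ((((g p.1 - g p.2)^2 : ℝ) : ℂ) * (Complex.exp (Complex.I * p.1)^q.1 * Complex.exp (Complex.I * p.2)^q.2)) := by
      intro p
      unfold Sm
      rw [mul_left_comm, Finset.mul_sum]
      congr 1
      apply Finset.sum_congr rfl; intro q _; ring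
    simp only [e]
    rw [integral_const_mul, integral_finsetSum _ (fun q _ => cont_int (by fun_prop))]
    simp only [integral_const_mul]
    have : ∀ q ∈ Finset.HasAntidiagonal.antidiagonal m, ((q.1:ℂ) * q.2) * (∫ p : ℝ × ℝ, (((g p.1 - g p.2)^2 : ℝ) : ℂ) * (Complex.exp (Complex.I * p.1)^q.1 * Complex.exp (Complex.I * p.2)^q.2) ∂(μ.prod μ))
        = -2 * (((q.1:ℂ) * q.2) * (Fc (fun s => (g s : ℂ)) q.1 * Fc (fun s => (g s : ℂ)) q.2)) := by
      rintro ⟨a, b⟩ _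
      rcases a with _ | a
      · simp
      rcases b with _ | b
      · simp
      simp only
      rw [quad_term hg]; ring
    rw [Finset.sum_congr rfl this, ← Finset.mul_sum]; ring
  have h2 := congrArg Complex.re h1
  rw [← Complex.reCLM_apply, ← ContinuousLinearMap.integral_comp_comm _ (cont_int (by fun_prop))] at h2
  rw [← h2]
  congr 1; ext p
  rw [Complex.reCLM_apply, Complex.re_ofReal_mul]

/-- change of variables -/
lemma cov1 {φ φ' : ℝ → ℝ} (hd : ∀ t, HasDerivAt φ (φ' t) t) (hpos : ∀ t, 0 < φ' t) (h0 : φ 0 = 0) (h1 : φ (2*π) = 2*π)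
    (g : ℝ → ENNReal) : ∫⁻ x, g x ∂μ = ∫⁻ x, ENNReal.ofReal (φ' x) * g (φ x) ∂μ := by
  have hm : StrictMono φ := strictMono_of_deriv_pos fun x => by rw [(hd x).deriv]; exact hpos x
  have hc : Continuous φ := continuous_iff_continuousAt.2 fun x => (hd x).continuousAt
  have him : φ '' Ioc 0 (2*π) = Ioc 0 (2*π) := by
    apply Subset.antisymm
    · rintro _ ⟨x, hx, rfl⟩
      exact ⟨by rw [← h0]; exact hm hx.1, by rw [← h1]; exact hm.monotone hx.2⟩
    · have := intermediate_value_Ioc (show (0:ℝ) ≤ 2*π by positivity) hc.continuousOn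
      rwa [h0, h1] at this
  have := lintegral_image_eq_lintegral_abs_deriv_mul (s := Ioc 0 (2*π)) measurableSet_Ioc
    (fun x _ => (hd x).hasDerivWithinAt) (hm.injective.injOn) g
  rw [him] at this
  unfold μ
  rw [this]
  congr 1; ext x
  rw [abs_of_pos (hpos x)]

lemma cov2 {φ φ' : ℝ → ℝ} (hd : ∀ t, HasDerivAt φ (φ' t) t) (hpos : ∀ t, 0 < φ' t) (h0 : φ 0 = 0) (h1 : φ (2*π) = 2*π)
    (hφ' : Continuous φ') {g : ℝ × ℝ → ℝ} (hg : Measurable g) :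
    ∫⁻ p, ENNReal.ofReal (g p) ∂(μ.prod μ) = ∫⁻ p : ℝ × ℝ, ENNReal.ofReal (g (φ p.1, φ p.2) * (φ' p.1 * φ' p.2)) ∂(μ.prod μ) := by
  have hc : Continuous φ := continuous_iff_continuousAt.2 fun x => (hd x).continuousAt
  rw [lintegral_prod _ (by fun_prop), lintegral_prod _ (by fun_prop), cov1 hd hpos h0 h1]
  congr 1; ext s
  rw [cov1 hd hpos h0 h1, ← lintegral_const_mul _ (by fun_prop)]
  congr 1; ext t
  rw [← ENNReal.ofReal_mul (hpos t).le, ← ENNReal.ofReal_mul (hpos s).le]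
  congr 1; ring

lemma per_eq_of_sin {w : ℝ → ℝ} (hw : Function.Periodic w (2*π)) {s t : ℝ} (hS : Real.sin ((s-t)/2) = 0) : w s = w t := by
  obtain ⟨n, hn⟩ := Real.sin_eq_zero_iff.1 hS
  have := hw.int_mul n t
  rw [← this]; congr 1; linarith

lemma exists_inv {c : ℂ} (hc : ‖c‖ ≤ 1) (m : ℕ) {ε : ℝ} (hε : 2*m*|ε| ≤ 1/10) :
    (∀ t, 0 < 1 + ε * Xd c m t) ∧ ∃ ψ : ℝ → ℝ, Continuous ψ ∧ Monotone ψ ∧ ψ 0 = 0 ∧ (∀ t, ψ (t+2*π) = ψ t + 2*π) ∧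
      ∀ t, ψ (t + ε * X c m t) = t := by
  have hpos : ∀ t, 0 < 1 + ε * Xd c m t := by
    intro t
    have : |ε * Xd c m t| ≤ 1/10 := by
      rw [abs_mul]; have := mul_le_mul_of_nonneg_left (Xd_bound hc m t) (abs_nonneg ε); linarith
    linarith [(abs_le.1 this).1]
  refine ⟨hpos, ?_⟩
  have hm : StrictMono fun t => t + ε * X c m t := strictMono_of_deriv_pos fun x => by
    have h1 : HasDerivAt (fun t => t + ε * X c m t) (1 + ε * Xd c m x) x :=
      (hasDerivAt_id' x).add ((X_deriv c m x).const_mul ε)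
    rw [h1.deriv]; exact hpos x
  have hX := X_cont c m
  have hX0 : X c m 0 = 0 := by simp [X]
  have hb : ∀ t, |ε * X c m t| ≤ 1/10 := by
    intro t
    have h1 := X_diff hc m t 0
    rw [hX0, sub_zero] at h1
    have h2 := Real.abs_sin_le_one ((t-0)/2)
    have h3 : |X c m t| ≤ 2*m := h1.trans (by
      have : (0:ℝ) ≤ 2*m := by positivity
      nlinarith)
    rw [abs_mul]; have := mul_le_mul_of_nonneg_left h3 (abs_nonneg ε); linarith
  have hsurj : Function.Surjective fun t => t + ε * X c m t := by
    apply Continuous.surjective (by fun_prop)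
    · apply tendsto_atTop_mono (f := fun t : ℝ => t - 1/10)
      · intro t; linarith [(abs_le.1 (hb t)).1]
      · exact tendsto_atTop_add_const_right _ (-(1/10)) tendsto_id
    · apply tendsto_atBot_mono (f := fun t : ℝ => t + 1/10)
      · intro t; linarith [(abs_le.1 (hb t)).2]
      · exact tendsto_atBot_add_const_right _ (1/10) tendsto_id
  let Φ := hm.orderIsoOfSurjective _ hsurj
  have hΦ : ∀ t, Φ t = t + ε * X c m t := fun t => rfl
  have hinv : ∀ t, Φ.symm (t + ε * X c m t) = t := fun t => by rw [← hΦ]; exact Φ.symm_apply_apply t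
  refine ⟨Φ.symm, Φ.symm.continuous, Φ.symm.monotone, ?_, ?_, hinv⟩
  · have := hinv 0; rwa [hX0, mul_zero, zero_add] at this
  · intro t
    have h1 : t = Φ.symm t + ε * X c m (Φ.symm t) := by rw [← hΦ]; exact (Φ.apply_symm_apply t).symm
    have h2 := hinv (Φ.symm t + 2*π)
    rw [X_per c m] at h2
    rw [← h2]; congr 1; linarith

end JW


namespace JW
open Real MeasureTheory Set Filter Topology

lemma pw_alg {D v x K K' W a b κ n ε G : ℝ} (hn : 0 ≤ n) (he : n*|ε| ≤ 1/10) (hκ : |κ| ≤ 3*n) (ha : |a| ≤ n) (hb : |b| ≤ n)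
    (hD : 0 ≤ D) (hK : 0 ≤ K) (hG : 0 ≤ G) (hw : K'*W ≤ K*(1+ε*κ+10*(n*|ε|)^2)) (hW : W = (1+ε*a)*(1+ε*b)) :
    ((D+(v-ε*x)^2)*K'+G)*W ≤ (D+v^2)*K+G + ε*((D+v^2)*(K*κ) - 2*(v*x*K) + G*(a+b)) + ε^2*(11*n^2+4*n+2)*((D+v^2+x^2)*K+G) := by
  have hA : 0 ≤ D+(v-ε*x)^2 := by positivity
  have h1 := mul_le_mul_of_nonneg_left hw hA
  have hab : a*b ≤ n^2 := by
    have := mul_le_mul ha hb (abs_nonneg b) hn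
    rw [← abs_mul] at this
    nlinarith [le_abs_self (a*b)]
  have h2 : G*W ≤ G*(1+ε*(a+b)+ε^2*n^2) := by
    apply mul_le_mul_of_nonneg_left _ hG
    rw [hW]; nlinarith [mul_le_mul_of_nonneg_left hab (sq_nonneg ε)]
  have hεκ : |ε*κ| ≤ 3/10 := by
    rw [abs_mul]; nlinarith [mul_le_mul_of_nonneg_left hκ (abs_nonneg ε)]
  have hsq : (n*|ε|)^2 = n^2*ε^2 := by rw [mul_pow, sq_abs]
  have he2 : (n*|ε|)^2 ≤ 1/100 := by
    have : 0 ≤ n*|ε| := by positivity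
    nlinarith
  have h10 : |10*n^2*ε| ≤ n := by
    rw [abs_mul, abs_of_nonneg (by positivity)]; nlinarith
  have hk4 : |κ+10*n^2*ε| ≤ 4*n := (abs_add_le _ _).trans (by linarith)
  have h3 : -2*(v*x)*(κ+10*n^2*ε) ≤ (v^2+x^2)*(4*n) := by
    have e1 : |2*(v*x)| ≤ v^2+x^2 := by
      rw [abs_le]; constructor <;> nlinarith [sq_nonneg (v+x), sq_nonneg (v-x)]
    have := mul_le_mul e1 hk4 (abs_nonneg _) (by positivity)
    rw [← abs_mul] at this
    nlinarith [neg_abs_le (2*(v*x)*(κ+10*n^2*ε))]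
  have h4 : x^2*(1+ε*κ+10*(n^2*ε^2)) ≤ x^2*2 := by
    apply mul_le_mul_of_nonneg_left _ (sq_nonneg x)
    rw [← hsq]; linarith [(abs_le.1 hεκ).2]
  have h5 := mul_le_mul_of_nonneg_left (add_le_add h3 h4) (mul_nonneg (sq_nonneg ε) hK)
  rw [hsq] at h1
  have p1 : 0 ≤ ε^2*(n^2*K*(D+v^2)) := by positivity
  have p2 : 0 ≤ ε^2*(n^2*K*x^2) := by positivity
  have p3 : 0 ≤ ε^2*(n*K*D) := by positivity
  have p5 : 0 ≤ ε^2*(K*(D+v^2)) := by positivity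
  have p6 : 0 ≤ ε^2*(G*(10*n^2+4*n+2)) := by positivity
  clear hW hw he hκ ha hb hsq he2 h10 hk4 h3 h4 hεκ hab
  linarith

noncomputable def Qf (f : ℝ → ℝ) (M : ℝ) (h : ℝ → ℝ) (p : ℝ × ℝ) : ℝ :=
  en (fun t => f (h t)) p + en (fun t => h t - t) p + (f (h p.1) + f (h p.2) + 2*M)

noncomputable def Φ (f : ℝ → ℝ) (M : ℝ) (h : ℝ → ℝ) : ENNReal := ∫⁻ p, ENNReal.ofReal (Qf f M h p) ∂(μ.prod μ)

lemma en_nonneg (w : ℝ → ℝ) (p : ℝ × ℝ) : 0 ≤ en w p := mul_nonneg (sq_nonneg _) (ker_nonneg _)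

lemma en_meas {w : ℝ → ℝ} (hw : Continuous w) : Measurable (en w) := by
  unfold en; have := ker_meas; fun_prop

lemma Qf_nonneg {f : ℝ → ℝ} {M : ℝ} (hM : ∀ x, |f x| ≤ M) (h : ℝ → ℝ) (p : ℝ × ℝ) : 0 ≤ Qf f M h p := by
  have h1 := abs_le.1 (hM (h p.1))
  have h2 := abs_le.1 (hM (h p.2))
  have := en_nonneg (fun t => f (h t)) p
  have := en_nonneg (fun t => h t - t) p
  unfold Qf; linarith

lemma Qf_meas {f : ℝ → ℝ} (hf : Continuous f) (M : ℝ) {h : ℝ → ℝ} (hh : Continuous h) : Measurable (Qf f M h) := by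
  have h1 := en_meas (w := fun t => f (h t)) (by fun_prop)
  have h2 := en_meas (w := fun t => h t - t) (by fun_prop)
  unfold Qf; fun_prop

lemma Qf_int {f : ℝ → ℝ} (hf : Continuous f) {M : ℝ} (hM : ∀ x, |f x| ≤ M) {h : ℝ → ℝ} (hh : Continuous h)
    (hfin : Φ f M h < ⊤) : Integrable (Qf f M h) (μ.prod μ) := by
  refine ⟨(Qf_meas hf M hh).aestronglyMeasurable, ?_⟩
  rw [hasFiniteIntegral_iff_ofReal (Eventually.of_forall (Qf_nonneg hM h))]
  exact hfin

lemma en_int {f : ℝ → ℝ} (hf : Continuous f) {M : ℝ} (hM : ∀ x, |f x| ≤ M) {h : ℝ → ℝ} (hh : Continuous h)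
    (hfin : Φ f M h < ⊤) : Integrable (en (fun t => f (h t))) (μ.prod μ) ∧ Integrable (en (fun t => h t - t)) (μ.prod μ) := by
  have hQ := Qf_int hf hM hh hfin
  have key : ∀ p : ℝ × ℝ, 0 ≤ f (h p.1) + f (h p.2) + 2*M := fun p => by
    have h1 := abs_le.1 (hM (h p.1))
    have h2 := abs_le.1 (hM (h p.2))
    linarith
  constructor
  · refine hQ.mono' (en_meas (by fun_prop)).aestronglyMeasurable (Eventually.of_forall fun p => ?_)
    rw [Real.norm_of_nonneg (en_nonneg _ _)]; unfold Qf
    linarith [key p, en_nonneg (fun t => h t - t) p]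
  · refine hQ.mono' (en_meas (by fun_prop)).aestronglyMeasurable (Eventually.of_forall fun p => ?_)
    rw [Real.norm_of_nonneg (en_nonneg _ _)]; unfold Qf
    linarith [key p, en_nonneg (fun t => f (h t)) p]

lemma enX_bound {c : ℂ} (hc : ‖c‖ ≤ 1) (m : ℕ) (p : ℝ × ℝ) : en (X c m) p ≤ m^2 := by
  unfold en ker
  have h1 := X_diff hc m p.1 p.2
  by_cases hS : Real.sin ((p.1-p.2)/2) = 0
  · rw [hS]; simp
  rw [mul_one_div, div_le_iff₀ (by positivity), ← sq_abs]
  have := pow_le_pow_left₀ (abs_nonneg _) h1 2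
  rw [mul_pow, sq_abs (Real.sin _)] at this
  linarith

lemma enX_int {c : ℂ} (hc : ‖c‖ ≤ 1) (m : ℕ) : Integrable (en (X c m)) (μ.prod μ) := by
  refine (integrable_const ((m:ℝ)^2)).mono' (en_meas (X_cont c m)).aestronglyMeasurable (Eventually.of_forall fun p => ?_)
  rw [Real.norm_of_nonneg (en_nonneg _ _)]; exact enX_bound hc m p

lemma kap_meas (c : ℂ) (m : ℕ) : Measurable fun p : ℝ × ℝ => kap c m p.1 p.2 := by
  have := X_cont c m
  have := Xd_cont c m
  unfold kap; fun_prop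

lemma enkap_int {c : ℂ} (hc : ‖c‖ ≤ 1) (m : ℕ) {w : ℝ → ℝ} (hi : Integrable (en w) (μ.prod μ)) :
    Integrable (fun p => en w p * kap c m p.1 p.2) (μ.prod μ) :=
  hi.mul_bdd (c := 6*m) (kap_meas c m).aestronglyMeasurable (Eventually.of_forall fun p => kap_bound hc m p.1 p.2)

lemma cross_int {c : ℂ} (hc : ‖c‖ ≤ 1) (m : ℕ) {w : ℝ → ℝ} (hw : Continuous w) (hi : Integrable (en w) (μ.prod μ)) :
    Integrable (fun p : ℝ × ℝ => (w p.1-w p.2)*(X c m p.1 - X c m p.2)*ker (p.1-p.2)) (μ.prod μ) := by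
  have hX := X_cont c m
  have hk := ker_meas
  refine (hi.add (enX_int hc m)).mono' (Measurable.aestronglyMeasurable (by fun_prop)) (Eventually.of_forall fun p => ?_)
  have k0 := ker_nonneg (p.1-p.2)
  simp only [Pi.add_apply, en]
  rw [Real.norm_eq_abs, abs_mul, abs_of_nonneg k0, ← add_mul]
  apply mul_le_mul_of_nonneg_right _ k0
  rw [abs_le]; constructor <;> nlinarith [sq_nonneg (w p.1-w p.2+(X c m p.1 - X c m p.2)), sq_nonneg (w p.1-w p.2-(X c m p.1 - X c m p.2))]

noncomputable def Q1 (u v : ℝ → ℝ) (M : ℝ) (c : ℂ) (m : ℕ) (p : ℝ × ℝ) : ℝ :=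
  en u p * kap c m p.1 p.2 + en v p * kap c m p.1 p.2 - 2 * ((v p.1-v p.2)*(X c m p.1 - X c m p.2)*ker (p.1-p.2))
   + (u p.1 + u p.2 + 2*M) * (Xd c m p.1 + Xd c m p.2)

noncomputable def Q2 (u v : ℝ → ℝ) (M : ℝ) (c : ℂ) (m : ℕ) (p : ℝ × ℝ) : ℝ :=
  en u p + en v p + en (X c m) p + (u p.1 + u p.2 + 2*M)

lemma Q1_int {c : ℂ} (hc : ‖c‖ ≤ 1) (m : ℕ) {u v : ℝ → ℝ} (M : ℝ) (hu : Continuous u) (hv : Continuous v)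
   (hui : Integrable (en u) (μ.prod μ)) (hvi : Integrable (en v) (μ.prod μ)) : Integrable (Q1 u v M c m) (μ.prod μ) := by
  have := Xd_cont c m
  exact (((enkap_int hc m hui).add (enkap_int hc m hvi)).sub ((cross_int hc m hv hvi).const_mul 2)).add (cont_int (by fun_prop))

lemma Q2_int {c : ℂ} (hc : ‖c‖ ≤ 1) (m : ℕ) {u v : ℝ → ℝ} (M : ℝ) (hu : Continuous u)
   (hui : Integrable (en u) (μ.prod μ)) (hvi : Integrable (en v) (μ.prod μ)) : Integrable (Q2 u v M c m) (μ.prod μ) := by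
  exact ((hui.add hvi).add (enX_int hc m)).add (cont_int (by fun_prop))

lemma pw {f : ℝ → ℝ} (hfp : Function.Periodic f (2*π)) {M : ℝ} (hM : ∀ x, |f x| ≤ M) {h : ℝ → ℝ} (hh : IsLift h)
    {c : ℂ} (hc : ‖c‖ ≤ 1) (m : ℕ) {ε : ℝ} (hε : 2*m*|ε| ≤ 1/10) {ψ : ℝ → ℝ} (hψ : ∀ t, ψ (t + ε * X c m t) = t) (p : ℝ × ℝ) :
    Qf f M (h ∘ ψ) (p.1 + ε * X c m p.1, p.2 + ε * X c m p.2) * ((1 + ε * Xd c m p.1) * (1 + ε * Xd c m p.2)) ≤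
      Qf f M h p + ε * Q1 (fun t => f (h t)) (fun t => h t - t) M c m p
       + ε^2 * (11*(2*m)^2+4*(2*m)+2) * Q2 (fun t => f (h t)) (fun t => h t - t) M c m p := by
  obtain ⟨s, t⟩ := p
  have g1 := abs_le.1 (hM (h s))
  have g2 := abs_le.1 (hM (h t))
  have hup : Function.Periodic (fun t => f (h t)) (2*π) := fun t => by simp only [hh.per]; exact hfp _
  by_cases hS : Real.sin ((s-t)/2) = 0
  · have eu := per_eq_of_sin hup hS
    have ev := per_eq_of_sin hh.vper hS
    have eX := per_eq_of_sin (X_per c m) hS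
    have := pw_alg (D := (f (h s) - f (h t))^2) (v := (h s - s) - (h t - t)) (x := X c m s - X c m t) (K := ker (s-t)) (K' := 0)
      (W := (1 + ε * Xd c m s) * (1 + ε * Xd c m t)) (a := Xd c m s) (b := Xd c m t) (κ := kap c m s t) (n := 2*m) (ε := ε)
      (G := f (h s) + f (h t) + 2*M) (by positivity) hε (by linarith [kap_bound hc m s t]) (Xd_bound hc m s) (Xd_bound hc m t)
      (sq_nonneg _) (ker_nonneg _) (by linarith) (by simp [ker, hS]) rfl
    simp only [Qf, Q1, Q2, en, Function.comp, hψ]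
    have eu : f (h s) = f (h t) := eu
    have ev : h s - s = h t - t := ev
    rw [show h s - (s + ε * X c m s) - (h t - (t + ε * X c m t)) = 0 by rw [eX]; linarith, eu]
    rw [eu, show ker (s-t) = 0 by simp [ker, hS]] at this
    rw [show ker (s-t) = 0 by simp [ker, hS]]
    linarith
  · have := pw_alg (D := (f (h s) - f (h t))^2) (v := (h s - s) - (h t - t)) (x := X c m s - X c m t) (K := ker (s-t))
      (K' := ker ((s + ε * X c m s) - (t + ε * X c m t)))
      (W := (1 + ε * Xd c m s) * (1 + ε * Xd c m t)) (a := Xd c m s) (b := Xd c m t) (κ := kap c m s t) (n := 2*m) (ε := ε)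
      (G := f (h s) + f (h t) + 2*M) (by positivity) hε (by linarith [kap_bound hc m s t]) (Xd_bound hc m s) (Xd_bound hc m t)
      (sq_nonneg _) (ker_nonneg _) (by linarith) (weight hc m hε s t hS) rfl
    simp only [Qf, Q1, Q2, en, Function.comp, hψ]
    rw [show h s - (s + ε * X c m s) - (h t - (t + ε * X c m t)) = (h s - s) - (h t - t) - ε * (X c m s - X c m t) by ring]
    linarith

lemma var_eps {f : ℝ → ℝ} (hf : Continuous f) (hfp : Function.Periodic f (2*π)) {M : ℝ} (hM : ∀ x, |f x| ≤ M) {h : ℝ → ℝ} (hh : IsLift h)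
    (hfin : Φ f M h < ⊤) (hmin : ∀ H, IsLift H → H 0 = h 0 → Φ f M h ≤ Φ f M H)
    {c : ℂ} (hc : ‖c‖ ≤ 1) (m : ℕ) {ε : ℝ} (hε : 2*m*|ε| ≤ 1/10) :
    0 ≤ ε * ∫ p, Q1 (fun t => f (h t)) (fun t => h t - t) M c m p ∂(μ.prod μ)
       + ε^2 * ((11*(2*m)^2+4*(2*m)+2) * ∫ p, Q2 (fun t => f (h t)) (fun t => h t - t) M c m p ∂(μ.prod μ)) := by
  obtain ⟨hpos, ψ, ψc, ψm, ψ0, ψp, hψ⟩ := exists_inv hc m hε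
  have hhc := hh.cont
  have hH : IsLift (h ∘ ψ) := ⟨hh.cont.comp ψc, hh.mono.comp ψm, fun t => by simp only [Function.comp, ψp, hh.per]⟩
  have h1 := hmin _ hH (by simp [ψ0])
  have hX0 : X c m 0 = 0 := by simp [X]
  have hX1 : X c m (2*π) = 0 := by rw [← hX0, ← X_per c m 0, zero_add]
  have hXd := Xd_cont c m
  obtain ⟨i1, i2⟩ := en_int hf hM hhc hfin
  have iQ := Qf_int hf hM hhc hfin
  have iQ1 := Q1_int hc m M (u := fun t => f (h t)) (v := fun t => h t - t) (by fun_prop) (by fun_prop) i1 i2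
  have iQ2 := Q2_int hc m M (u := fun t => f (h t)) (v := fun t => h t - t) (by fun_prop) i1 i2
  have hcov := cov2 (φ := fun t => t + ε * X c m t) (φ' := fun t => 1 + ε * Xd c m t)
    (fun t => (hasDerivAt_id' t).add ((X_deriv c m t).const_mul ε)) hpos (by simp [hX0]) (by simp [hX1]) (by fun_prop)
    (Qf_meas hf M hH.cont)
  have hR : Integrable (fun p => Qf f M h p + ε * Q1 (fun t => f (h t)) (fun t => h t - t) M c m p
       + ε^2 * (11*(2*m)^2+4*(2*m)+2) * Q2 (fun t => f (h t)) (fun t => h t - t) M c m p) (μ.prod μ) :=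
    (iQ.add (iQ1.const_mul _)).add (iQ2.const_mul _)
  have hR0 : ∀ p, 0 ≤ Qf f M h p + ε * Q1 (fun t => f (h t)) (fun t => h t - t) M c m p
       + ε^2 * (11*(2*m)^2+4*(2*m)+2) * Q2 (fun t => f (h t)) (fun t => h t - t) M c m p := fun p =>
    (mul_nonneg (Qf_nonneg hM _ _) (mul_nonneg (hpos _).le (hpos _).le)).trans (pw hfp hM hh hc m hε hψ p)
  have h2 : Φ f M (h ∘ ψ) ≤ ∫⁻ p, ENNReal.ofReal (Qf f M h p + ε * Q1 (fun t => f (h t)) (fun t => h t - t) M c m p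
       + ε^2 * (11*(2*m)^2+4*(2*m)+2) * Q2 (fun t => f (h t)) (fun t => h t - t) M c m p) ∂(μ.prod μ) := by
    unfold Φ
    rw [hcov]
    exact lintegral_mono fun p => ENNReal.ofReal_le_ofReal (pw hfp hM hh hc m hε hψ p)
  have h3 := h1.trans h2
  rw [← ofReal_integral_eq_lintegral_ofReal hR (Eventually.of_forall hR0)] at h3
  unfold Φ at h3
  rw [← ofReal_integral_eq_lintegral_ofReal iQ (Eventually.of_forall (Qf_nonneg hM h)),
    ENNReal.ofReal_le_ofReal_iff (integral_nonneg hR0)] at h3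
  have j1 : Integrable (fun p => Qf f M h p + ε * Q1 (fun t => f (h t)) (fun t => h t - t) M c m p) (μ.prod μ) := iQ.add (iQ1.const_mul _)
  rw [integral_add j1 (iQ2.const_mul _), integral_add iQ (iQ1.const_mul _), integral_const_mul, integral_const_mul] at h3
  linarith

lemma var_zero {f : ℝ → ℝ} (hf : Continuous f) (hfp : Function.Periodic f (2*π)) {M : ℝ} (hM : ∀ x, |f x| ≤ M) {h : ℝ → ℝ} (hh : IsLift h)
    (hfin : Φ f M h < ⊤) (hmin : ∀ H, IsLift H → H 0 = h 0 → Φ f M h ≤ Φ f M H)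
    {c : ℂ} (hc : ‖c‖ ≤ 1) (m : ℕ) : ∫ p, Q1 (fun t => f (h t)) (fun t => h t - t) M c m p ∂(μ.prod μ) = 0 := by
  set a := ∫ p, Q1 (fun t => f (h t)) (fun t => h t - t) M c m p ∂(μ.prod μ) with ha
  set b := (11*(2*(m:ℝ))^2+4*(2*m)+2) * ∫ p, Q2 (fun t => f (h t)) (fun t => h t - t) M c m p ∂(μ.prod μ) with hb
  have key : ∀ ε : ℝ, 2*m*|ε| ≤ 1/10 → 0 ≤ ε * a + ε^2 * b := fun ε hε => var_eps hf hfp hM hh hfin hmin hc m hε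
  have hm0 : (0:ℝ) ≤ m := by positivity
  -- choose small step
  by_contra hne
  have hapos : 0 < |a| := abs_pos.2 hne
  set B := |b| + 1 with hB
  have hBp : 0 < B := by positivity
  set δ : ℝ := min (1/(20*((m:ℝ)+1))) (|a|/(2*B)) with hδ
  have hδ0 : 0 < δ := lt_min (by positivity) (by positivity)
  have hδ1 : δ*(20*(m+1)) ≤ 1 := by
    have := min_le_left (1/(20*((m:ℝ)+1))) (|a|/(2*B))
    rwa [← hδ, le_div_iff₀ (by positivity)] at this
  have hδ2 : δ*(2*B) ≤ |a| := by
    have := min_le_right (1/(20*((m:ℝ)+1))) (|a|/(2*B))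
    rwa [← hδ, le_div_iff₀ (by positivity)] at this
  have hs : 2*m*δ ≤ 1/10 := by nlinarith
  have k1 := key δ (by rwa [abs_of_pos hδ0])
  have k2 := key (-δ) (by rwa [abs_neg, abs_of_pos hδ0])
  have hbB : δ^2*b ≤ δ^2*B := mul_le_mul_of_nonneg_left (by linarith [le_abs_self b]) (sq_nonneg _)
  have : δ*|a| ≤ δ^2*B := by
    rcases abs_cases a with ⟨e,_⟩ | ⟨e,_⟩ <;> rw [e] <;> nlinarith
  have : δ*(δ*(2*B)) ≤ δ^2*B := (mul_le_mul_of_nonneg_left hδ2 hδ0.le).trans this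
  have : 0 < δ^2*B := by positivity
  nlinarith

end JW


namespace JW
open Real MeasureTheory Set Filter Topology

lemma enkap_eq {w : ℝ → ℝ} (hp : Function.Periodic w (2*π)) (c : ℂ) (m : ℕ) (p : ℝ × ℝ) :
    en w p * kap c m p.1 p.2 = (w p.1 - w p.2)^2 * (-Complex.I * c * Sm m (Complex.exp (Complex.I * p.1)) (Complex.exp (Complex.I * p.2))).re := by
  by_cases hS : Real.sin ((p.1-p.2)/2) = 0
  · rw [en, per_eq_of_sin hp hS]; simp
  · rw [← kernel_id c m _ _ hS]; unfold en; ring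

lemma int_Xd_mul {u : ℝ → ℝ} (hu : Continuous u) (c : ℂ) (m : ℕ) :
    ∫ t, u t * Xd c m t ∂μ = (c * (Complex.I * m * Fc (fun s => (u s : ℂ)) m)).re := by
  have h1 : ∫ t, c * (Complex.I * m * ((u t : ℂ) * Complex.exp (Complex.I * (m:ℤ) * t))) ∂μ = c * (Complex.I * m * Fc (fun s => (u s : ℂ)) m) := by
    rw [integral_const_mul, integral_const_mul, integral_μ]; rfl
  have hi : Integrable (fun t : ℝ => c * (Complex.I * m * ((u t : ℂ) * Complex.exp (Complex.I * (m:ℤ) * t)))) μ := by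
    unfold μ
    exact (Continuous.integrableOn_Ioc (by fun_prop))
  rw [← h1, ← Complex.reCLM_apply, ← ContinuousLinearMap.integral_comp_comm _ hi]
  congr 1; ext t
  rw [Complex.reCLM_apply, Xd, ← Complex.re_ofReal_mul]
  congr 1; push_cast; ring

lemma int_Xd (c : ℂ) {m : ℕ} (hm : m ≠ 0) : ∫ t, Xd c m t ∂μ = 0 := by
  have := int_Xd_mul (u := fun _ => 1) continuous_const c m
  simp only [one_mul] at this
  obtain ⟨k, rfl⟩ := Nat.exists_eq_succ_of_ne_zero hm
  rw [this]
  have h := Fc_one k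
  simp only [Complex.ofReal_one]
  rw [Nat.succ_eq_add_one, h]; simp

lemma last_term {u : ℝ → ℝ} (hu : Continuous u) (M : ℝ) (c : ℂ) {m : ℕ} (hm : m ≠ 0) :
    ∫ p : ℝ × ℝ, (u p.1 + u p.2 + 2*M) * (Xd c m p.1 + Xd c m p.2) ∂(μ.prod μ) = 4 * π * (c * (Complex.I * m * Fc (fun s => (u s : ℂ)) m)).re := by
  have hX := Xd_cont c m
  have e : ∀ p : ℝ × ℝ, (u p.1 + u p.2 + 2*M) * (Xd c m p.1 + Xd c m p.2) =
     (u p.1 * Xd c m p.1 + 2*M* Xd c m p.1) * 1 + u p.1 * Xd c m p.2 + Xd c m p.1 * u p.2 + 1 * (u p.2 * Xd c m p.2 + 2*M*Xd c m p.2) := by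
    intro p; ring
  simp only [e]
  have i1 : ∀ g : ℝ → ℝ, Continuous g → Integrable g μ := fun g hg => by
    unfold μ; exact hg.integrableOn_Ioc
  rw [integral_add (cont_int (by fun_prop)) (cont_int (by fun_prop)), integral_add (cont_int (by fun_prop)) (cont_int (by fun_prop)),
    integral_add (cont_int (by fun_prop)) (cont_int (by fun_prop)),
    integral_prod_mul (fun s => u s * Xd c m s + 2*M* Xd c m s) (fun _ => (1:ℝ)),
    integral_prod_mul (fun s => u s) (fun s => Xd c m s), integral_prod_mul (fun s => Xd c m s) (fun s => u s),
    integral_prod_mul (fun _ => (1:ℝ)) (fun s => u s * Xd c m s + 2*M* Xd c m s),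
    integral_add (i1 _ (by fun_prop)) (i1 _ (by fun_prop)), integral_const_mul, int_Xd c hm, int_Xd_mul hu, integral_μ (fun _ => (1:ℝ))]
  simp; ring

lemma int4 {a b c d : ℝ × ℝ → ℝ} (ha : Integrable a (μ.prod μ)) (hb : Integrable b (μ.prod μ)) (hc : Integrable c (μ.prod μ))
    (hd : Integrable d (μ.prod μ)) : ∫ p, (a p + b p - 2 * c p + d p) ∂(μ.prod μ) =
    ∫ p, a p ∂(μ.prod μ) + ∫ p, b p ∂(μ.prod μ) - 2 * ∫ p, c p ∂(μ.prod μ) + ∫ p, d p ∂(μ.prod μ) := by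
  have h1 : Integrable (fun p => a p + b p) (μ.prod μ) := ha.add hb
  have h2 : Integrable (fun p => a p + b p - 2 * c p) (μ.prod μ) := h1.sub (hc.const_mul 2)
  rw [integral_add h2 hd, integral_sub h1 (hc.const_mul 2), integral_add ha hb, integral_const_mul]

lemma relation {f : ℝ → ℝ} (hf : Continuous f) (hfp : Function.Periodic f (2*π)) {M : ℝ} (hM : ∀ x, |f x| ≤ M) {h : ℝ → ℝ} (hh : IsLift h)
    (hfin : Φ f M h < ⊤) (hmin : ∀ H, IsLift H → H 0 = h 0 → Φ f M h ≤ Φ f M H)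
    {m : ℕ} (hm : m ≠ 0) :
    (∑ p ∈ Finset.HasAntidiagonal.antidiagonal m, ((p.1:ℂ) * p.2) * (Fc (fun s => (f (h s) : ℂ)) p.1 * Fc (fun s => (f (h s) : ℂ)) p.2))
    + (∑ p ∈ Finset.HasAntidiagonal.antidiagonal m, ((p.1:ℂ) * p.2) * (Fc (fun s => ((h s - s : ℝ) : ℂ)) p.1 * Fc (fun s => ((h s - s : ℝ) : ℂ)) p.2))
    + 2 * π * m * (Fc (fun s => (f (h s) : ℂ)) m + Complex.I * Fc (fun s => ((h s - s : ℝ) : ℂ)) m) = 0 := by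
  have hhc := hh.cont
  have hup : Function.Periodic (fun t => f (h t)) (2*π) := fun t => by simp only [hh.per]; exact hfp _
  set U := ∑ p ∈ Finset.HasAntidiagonal.antidiagonal m, ((p.1:ℂ) * p.2) * (Fc (fun s => (f (h s) : ℂ)) p.1 * Fc (fun s => (f (h s) : ℂ)) p.2) with hU
  set V := ∑ p ∈ Finset.HasAntidiagonal.antidiagonal m, ((p.1:ℂ) * p.2) * (Fc (fun s => ((h s - s : ℝ) : ℂ)) p.1 * Fc (fun s => ((h s - s : ℝ) : ℂ)) p.2) with hV
  obtain ⟨i1, i2⟩ := en_int hf hM hhc hfin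
  have key : ∀ c : ℂ, ‖c‖ ≤ 1 → (c * (2 * Complex.I * (U + V + 2 * π * m * (Fc (fun s => (f (h s) : ℂ)) m + Complex.I * Fc (fun s => ((h s - s : ℝ) : ℂ)) m)))).re = 0 := by
    intro c hc
    have h0 := var_zero hf hfp hM hh hfin hmin hc m
    have hX := Xd_cont c m
    unfold Q1 at h0
    have i3 := cross_int hc m (w := fun t => h t - t) (by fun_prop) i2
    rw [int4 (enkap_int hc m i1) (enkap_int hc m i2) i3 (cont_int (by fun_prop)),
      pair_X (w := fun t => h t - t) (by fun_prop) hh.vper c m i3,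
      last_term (u := fun t => f (h t)) (by fun_prop) M c hm] at h0
    simp only [enkap_eq hup, enkap_eq hh.vper] at h0
    rw [quad (g := fun t => f (h t)) (by fun_prop), quad (g := fun t => h t - t) (by fun_prop), ← hU, ← hV] at h0
    rw [← h0]
    simp
    ring
  have h1 := key 1 (by simp)
  have h2 := key (-Complex.I) (by simp)
  set Z := U + V + 2 * π * m * (Fc (fun s => (f (h s) : ℂ)) m + Complex.I * Fc (fun s => ((h s - s : ℝ) : ℂ)) m) with hZ
  clear_value Z
  apply Complex.ext
  · simp at h2; simpa using h2
  · simp at h1; simpa using h1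

lemma Fc_comb {u v : ℝ → ℝ} (hu : Continuous u) (hv : Continuous v) (m : ℤ) :
    Fc (fun t => (u t : ℂ) + (v t : ℂ) * Complex.I) m = Fc (fun t => (u t : ℂ)) m + Complex.I * Fc (fun t => (v t : ℂ)) m := by
  unfold Fc
  rw [← intervalIntegral.integral_const_mul, ← intervalIntegral.integral_add (Continuous.intervalIntegrable (by fun_prop) _ _) (Continuous.intervalIntegrable (by fun_prop) _ _)]
  congr 1; ext t; ring

lemma conj_rel {f : ℝ → ℝ} (hf : Continuous f) (hfp : Function.Periodic f (2*π)) {M : ℝ} (hM : ∀ x, |f x| ≤ M) {h : ℝ → ℝ} (hh : IsLift h)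
    (hfin : Φ f M h < ⊤) (hmin : ∀ H, IsLift H → H 0 = h 0 → Φ f M h ≤ Φ f M H) (k : ℕ) :
    Fc (fun t => (f (h t) : ℂ) + ((h t - t : ℝ) : ℂ) * Complex.I) ((k+1:ℕ):ℤ) = 0 := by
  have hhc := hh.cont
  have key : ∀ m : ℕ, m ≠ 0 → Fc (fun s => (f (h s) : ℂ)) m + Complex.I * Fc (fun s => ((h s - s : ℝ) : ℂ)) m = 0 := by
    intro m
    induction m using Nat.strong_induction_on with
    | _ m ih =>
      intro hm
      have hr := relation hf hfp hM hh hfin hmin hm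
      rw [← Finset.sum_add_distrib, Finset.sum_eq_zero, zero_add] at hr
      · have : (2 * π * m : ℂ) ≠ 0 := by
          have : (π : ℂ) ≠ 0 := by exact_mod_cast Real.pi_ne_zero
          have : (m : ℂ) ≠ 0 := by exact_mod_cast hm
          exact mul_ne_zero (mul_ne_zero two_ne_zero ‹_›) ‹_›
        exact (mul_eq_zero.1 hr).resolve_left this
      · rintro ⟨a, b⟩ hab
        have hab := Finset.HasAntidiagonal.mem_antidiagonal.1 hab
        simp only at hab ⊢
        rcases Nat.eq_zero_or_pos a with rfl | ha
        · simp
        rcases Nat.eq_zero_or_pos b with rfl | hb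
        · simp
        have e1 := ih a (by omega) (by omega)
        have e2 := ih b (by omega) (by omega)
        rw [eq_neg_of_add_eq_zero_left e1, eq_neg_of_add_eq_zero_left e2]
        linear_combination ((a:ℂ) * b) * (Fc (fun s => ((h s - s : ℝ) : ℂ)) a * Fc (fun s => ((h s - s : ℝ) : ℂ)) b) * Complex.I_sq
  rw [Fc_comb (u := fun t => f (h t)) (v := fun t => h t - t) (by fun_prop) (by fun_prop)]
  exact key (k+1) (by omega)

end JW


namespace JW
open Real MeasureTheory Set Filter Topology

lemma lip_sin {f : ℝ → ℝ} (hfp : Function.Periodic f (2*π)) {L : ℝ} (hL0 : 0 ≤ L) (hL : ∀ x y, |f x - f y| ≤ L * |x-y|) (s t : ℝ) :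
    |f s - f t| ≤ π * L * |Real.sin ((s-t)/2)| := by
  have hp := Real.pi_pos
  set n := round ((s-t)/(2*π)) with hn
  have h1 := abs_sub_round ((s-t)/(2*π))
  rw [← hn] at h1
  set y := s - t - n*(2*π) with hy
  have hyb : |y| ≤ π := by
    have : y = ((s-t)/(2*π) - n) * (2*π) := by rw [hy]; field_simp
    rw [this, abs_mul, abs_of_pos (show 0 < 2*π by positivity)]
    nlinarith
  have e1 : f (t + y) = f s := by
    have := hfp.sub_int_mul_eq n (x := s)
    rw [← this]; congr 1; rw [hy]; ring
  have e2 : |Real.sin ((s-t)/2)| = |Real.sin (y/2)| := by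
    have : y/2 = (s-t)/2 - n*π := by rw [hy]; ring
    rw [this, Real.sin_sub_int_mul_pi, abs_mul, abs_neg_one_zpow, one_mul]
  have e3 : |y|/2 * (2/π) ≤ |Real.sin (y/2)| := by
    have := Real.mul_le_sin (x := |y|/2) (by positivity) (by linarith)
    have h4 : Real.sin (|y|/2) ≤ |Real.sin (y/2)| := by
      rcases abs_cases y with ⟨h,_⟩ | ⟨h,_⟩
      · rw [h]; exact le_abs_self _
      · rw [h, neg_div, Real.sin_neg]; exact neg_le_abs _
    linarith
  rw [← e1, e2]
  have h5 := hL (t+y) t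
  rw [add_sub_cancel_left] at h5
  have h6 : |y| ≤ π * |Real.sin (y/2)| := by
    have := mul_le_mul_of_nonneg_left e3 hp.le
    have e : π * (|y|/2 * (2/π)) = |y| := by field_simp
    linarith
  nlinarith

lemma Φ_id {f : ℝ → ℝ} (hfp : Function.Periodic f (2*π)) {M : ℝ} (hM : ∀ x, |f x| ≤ M)
    {L : ℝ} (hL0 : 0 ≤ L) (hL : ∀ x y, |f x - f y| ≤ L * |x-y|) : Φ f M id < ⊤ := by
  have hb : ∀ p, Qf f M id p ≤ (π*L)^2 + 4*M := by
    intro p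
    have h1 := abs_le.1 (hM p.1)
    have h2 := abs_le.1 (hM p.2)
    have h3 : en (fun t => f (id t)) p ≤ (π*L)^2 := by
      simp only [en, ker, id]
      by_cases hS : Real.sin ((p.1-p.2)/2) = 0
      · rw [hS]; simp; positivity
      rw [mul_one_div, div_le_iff₀ (by positivity), ← sq_abs]
      have := pow_le_pow_left₀ (abs_nonneg _) (lip_sin hfp hL0 hL p.1 p.2) 2
      rw [mul_pow, sq_abs (Real.sin _)] at this
      have : 0 ≤ (π*L)^2 * Real.sin ((p.1-p.2)/2)^2 := by positivity
      linarith
    have h4 : en (fun t => id t - t) p = 0 := by simp [en]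
    unfold Qf; rw [h4]; simp only [id] at *; linarith
  calc Φ f M id ≤ ∫⁻ _, ENNReal.ofReal ((π*L)^2 + 4*M) ∂(μ.prod μ) :=
        lintegral_mono fun p => ENNReal.ofReal_le_ofReal (hb p)
    _ < ⊤ := by
        rw [lintegral_const]; exact ENNReal.mul_lt_top ENNReal.ofReal_lt_top (measure_lt_top _ _)

lemma energy_log {f : ℝ → ℝ} (hf : Continuous f) {M : ℝ} (hM : ∀ x, |f x| ≤ M) {h : ℝ → ℝ} (hh : IsLift h)
    {A : ENNReal} (hA : A < ⊤) (hfin : Φ f M h ≤ A) (c : ℝ) {d : ℝ} (hd0 : 0 < d) (hd : d ≤ 1/2) {η : ℝ} (hη : 0 < η) :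
    (h (c+d) - h (c-d)) * Real.log (1/d) ≤ η * Real.log (1/d) + (A.toReal/(4*η) + 2*π) := by
  have hhc := hh.cont
  have hlt := hfin.trans_lt hA
  obtain ⟨i1, i2⟩ := en_int hf hM hhc hlt
  have iQ := Qf_int hf hM hhc hlt
  have hv : ∫ p, en (fun t => h t - t) p ∂(μ.prod μ) ≤ A.toReal := by
    have e1 : ∫ p, en (fun t => h t - t) p ∂(μ.prod μ) ≤ ∫ p, Qf f M h p ∂(μ.prod μ) := by
      apply integral_mono i2 iQ
      intro p
      have h1 := abs_le.1 (hM (h p.1))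
      have h2 := abs_le.1 (hM (h p.2))
      have := en_nonneg (fun t => f (h t)) p
      simp only [Qf]; linarith
    refine e1.trans ?_
    rw [integral_eq_lintegral_of_nonneg_ae (Eventually.of_forall (Qf_nonneg hM h)) iQ.aestronglyMeasurable]
    exact ENNReal.toReal_mono hA.ne hfin
  have hb := fun N => (bessel (w := fun t => h t - t) (by fun_prop) hh.vper i2 N).trans hv
  have hs := summable_of_sum_range_le (fun n => by positivity) hb
  have ht := Real.tsum_le_of_sum_range_le (fun n => by positivity) hb
  have := energy_mod hh hs ht c hd0 hd hη
  linarith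

lemma exists_min {f : ℝ → ℝ} (hf : Continuous f) (hfp : Function.Periodic f (2*π)) {M : ℝ} (hM : ∀ x, |f x| ≤ M)
    {L : ℝ} (hL0 : 0 ≤ L) (hL : ∀ x y, |f x - f y| ≤ L * |x-y|) :
    ∃ h, IsLift h ∧ (0 ≤ h 0 ∧ h 0 ≤ 2*π) ∧ Φ f M h < ⊤ ∧ ∀ H, IsLift H → H 0 = h 0 → Φ f M h ≤ Φ f M H := by
  set S : Set (ℝ → ℝ) := {h | IsLift h ∧ (0 ≤ h 0 ∧ h 0 ≤ 2*π)} with hS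
  set I := sInf (Φ f M '' S) with hI
  have hid : (id : ℝ → ℝ) ∈ S := ⟨⟨continuous_id, monotone_id, fun t => rfl⟩, by simp, by simp; positivity⟩
  have hIid : I ≤ Φ f M id := sInf_le ⟨id, hid, rfl⟩
  have hIt : I < ⊤ := hIid.trans_lt (Φ_id hfp hM hL0 hL)
  have hex : ∀ n : ℕ, ∃ h ∈ S, Φ f M h ≤ I + (n+1:ENNReal)⁻¹ := by
    intro n
    have h1 : I < I + (n+1:ENNReal)⁻¹ := ENNReal.lt_add_right hIt.ne (by simp)
    obtain ⟨_, ⟨h, hh, rfl⟩, h2⟩ := sInf_lt_iff.1 h1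
    exact ⟨h, hh, h2.le⟩
  choose h hhS hΦ using hex
  have hA : I + 1 < ⊤ := ENNReal.add_lt_top.2 ⟨hIt, ENNReal.one_lt_top⟩
  have hΦ1 : ∀ n, Φ f M (h n) ≤ I + 1 := fun n => (hΦ n).trans (by
    gcongr
    rw [ENNReal.inv_le_one]; simp)
  have hlog : ∀ η > 0, ∃ B : ℝ, ∀ n c d, 0 < d → d ≤ 1/2 →
    (h n (c+d) - h n (c-d)) * Real.log (1/d) ≤ η * Real.log (1/d) + B := fun η hη =>
    ⟨_, fun n c d hd0 hd => energy_log hf hM (hhS n).1 hA (hΦ1 n) c hd0 hd hη⟩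
  obtain ⟨φ, hφ, g, hg, hg0, hlim⟩ := lift_compact (fun n => (hhS n).1) (fun n => (hhS n).2) (equi_of_log hlog)
  have hgI : Φ f M g ≤ I := by
    have hpt : ∀ p, Tendsto (fun n => ENNReal.ofReal (Qf f M (h (φ n)) p)) atTop (𝓝 (ENNReal.ofReal (Qf f M g p))) := by
      intro p
      apply ENNReal.tendsto_ofReal
      have a1 := hlim p.1
      have a2 := hlim p.2
      have b1 := (hf.tendsto (g p.1)).comp a1
      have b2 := (hf.tendsto (g p.2)).comp a2
      simp only [Qf, en]
      exact ((((b1.sub b2).pow 2).mul_const _).add ((((a1.sub_const _).sub (a2.sub_const _)).pow 2).mul_const _)).add ((b1.add b2).add_const _)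
    have h1 : Φ f M g = ∫⁻ p, liminf (fun n => ENNReal.ofReal (Qf f M (h (φ n)) p)) atTop ∂(μ.prod μ) := by
      unfold Φ
      congr 1; ext p; rw [(hpt p).liminf_eq]
    rw [h1]
    refine (lintegral_liminf_le fun n => (Qf_meas hf M (hhS _).1.cont).ennreal_ofReal).trans ?_
    have ht : Tendsto (fun n => I + ((φ n:ENNReal)+1)⁻¹) atTop (𝓝 (I + 0)) := by
      apply Tendsto.const_add
      have e : Tendsto (fun n : ℕ => ((n:ENNReal))⁻¹) atTop (𝓝 0) := ENNReal.tendsto_inv_nat_nhds_zero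
      have := e.comp ((tendsto_add_atTop_nat 1).comp hφ.tendsto_atTop)
      simpa [Function.comp_def] using this
    rw [add_zero] at ht
    rw [← ht.liminf_eq]
    exact liminf_le_liminf (Eventually.of_forall fun n => hΦ (φ n))
  refine ⟨g, hg, hg0, hgI.trans_lt hIt, fun H hH hH0 => hgI.trans (sInf_le ⟨H, ⟨hH, by rwa [hH0]⟩, rfl⟩)⟩

lemma exists_conj_lip {f : ℝ → ℝ} (hfp : Function.Periodic f (2*π)) {M : ℝ} (hM : ∀ x, |f x| ≤ M)
    {L : ℝ} (hL0 : 0 ≤ L) (hL : ∀ x y, |f x - f y| ≤ L * |x-y|) :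
    ∃ h, IsLift h ∧ (0 ≤ h 0 ∧ h 0 ≤ 2*π) ∧
      ∀ k : ℕ, Fc (fun t => (f (h t) : ℂ) + ((h t - t : ℝ) : ℂ) * Complex.I) ((k+1:ℕ):ℤ) = 0 := by
  have hf : Continuous f := (LipschitzWith.of_dist_le_mul (K := ⟨L, hL0⟩) fun x y => by
    rw [Real.dist_eq, Real.dist_eq]; exact hL x y).continuous
  obtain ⟨h, hh, h0, hfin, hmin⟩ := exists_min hf hfp hM hL0 hL
  exact ⟨h, hh, h0, conj_rel hf hfp hM hh hfin hmin⟩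

lemma approx {f : ℝ → ℝ} (hf : Continuous f) (hfp : Function.Periodic f (2*π)) {M : ℝ} (hM : ∀ x, |f x| ≤ M) {δ : ℝ} (hδ : 0 < δ) :
    ∃ g : ℝ → ℝ, Function.Periodic g (2*π) ∧ (∃ L, 0 ≤ L ∧ ∀ x y, |g x - g y| ≤ L * |x-y|) ∧ ∀ x, ∃ ξ, |ξ - x| ≤ δ ∧ g x = f ξ := by
  have hi : ∀ a b, IntervalIntegrable f volume a b := fun a b => hf.intervalIntegrable a b
  have hM0 : 0 ≤ M := (abs_nonneg _).trans (hM 0)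
  refine ⟨fun x => δ⁻¹ * ∫ y in x..x+δ, f y, ?_, ⟨δ⁻¹ * (2*M), by positivity, ?_⟩, ?_⟩
  · intro x
    simp only
    congr 1
    have := intervalIntegral.integral_comp_add_right (a := x) (b := x+δ) f (2*π)
    rw [show x + 2*π + δ = x + δ + 2*π by ring, ← this]
    congr 1; ext y; exact hfp y
  · intro x y
    have key : ∀ a b, |∫ y in a..b, f y| ≤ M * |b-a| := fun a b => by
      rw [← Real.norm_eq_abs]
      exact intervalIntegral.norm_integral_le_of_norm_le_const fun x _ => hM x
    rw [← mul_sub, abs_mul, abs_of_pos (inv_pos.2 hδ), mul_assoc]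
    apply mul_le_mul_of_nonneg_left _ (by positivity)
    have e1 := intervalIntegral.integral_add_adjacent_intervals (hi y x) (hi x (x+δ))
    have e2 := intervalIntegral.integral_add_adjacent_intervals (hi y (y+δ)) (hi (y+δ) (x+δ))
    have : (∫ y in x..x+δ, f y) - ∫ z in y..y+δ, f z = (∫ z in (y+δ)..(x+δ), f z) - ∫ z in y..x, f z := by linarith
    rw [this]
    have k1 := key (y+δ) (x+δ)
    have k2 := key y x
    rw [show x+δ-(y+δ) = x - y by ring] at k1
    exact (abs_sub _ _).trans (by linarith)
  · intro x
    obtain ⟨ξ, hξ, e⟩ := exists_hasDerivAt_eq_slope (fun z => ∫ y in x..z, f y) f (show x < x+δ by linarith)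
      (intervalIntegral.continuous_primitive hi x).continuousOn (fun z _ => intervalIntegral.integral_hasDerivAt_right (hi _ _) (hf.stronglyMeasurableAtFilter _ _) hf.continuousAt)
    refine ⟨ξ, ?_, ?_⟩
    · rw [abs_le]; constructor <;> linarith [hξ.1, hξ.2]
    · rw [e]; simp; field_simp

end JW


namespace JW
open Real MeasureTheory Set Filter Topology

lemma exists_conj {f : ℝ → ℝ} (hf : Continuous f) (hfp : Function.Periodic f (2*π)) {M : ℝ} (hM : ∀ x, |f x| ≤ M) :
    ∃ h, IsLift h ∧ 
      ∀ k : ℕ, Fc (fun t => (f (h t) : ℂ) + ((h t - t : ℝ) : ℂ) * Complex.I) ((k+1:ℕ):ℤ) = 0 := by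
  choose g hgp hgL hgf using fun n : ℕ => approx hf hfp hM (δ := 1/((n:ℝ)+1)) (by positivity)
  choose L hL0 hL using hgL
  have hgM : ∀ n x, |g n x| ≤ M := fun n x => by
    obtain ⟨ξ, -, e⟩ := hgf n x
    rw [e]; exact hM ξ
  have hgc : ∀ n, Continuous (g n) := fun n => (LipschitzWith.of_dist_le_mul (K := ⟨L n, hL0 n⟩) fun x y => by
    rw [Real.dist_eq, Real.dist_eq]; exact hL n x y).continuous
  choose h hh h0 hc using fun n => exists_conj_lip (hgp n) (hgM n) (hL0 n) (hL n)
  have hlog : ∀ η > 0, ∃ B : ℝ, ∀ n c d, 0 < d → d ≤ 1/2 →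
    (h n (c+d) - h n (c-d)) * Real.log (1/d) ≤ η * Real.log (1/d) + B := by
    intro η hη
    refine ⟨2*π*M+2*π, fun n c d hd0 hd => ?_⟩
    have h1 := conj_mod (u := fun t => g n (h n t)) (hh n) ((hgc n).comp (hh n).cont)
      (fun t => by simp only [(hh n).per]; exact hgp n _) (fun t => hgM n _) (hc n) c hd0 hd
    have h2 : 0 ≤ Real.log (1/d) := Real.log_nonneg (by rw [le_div_iff₀ hd0]; linarith)
    nlinarith
  obtain ⟨φ, hφ, q, hq, hq0, hlim⟩ := lift_compact hh h0 (equi_of_log hlog)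
  refine ⟨q, hq, fun k => ?_⟩
  have hu : ∀ t, Tendsto (fun n => g (φ n) (h (φ n) t)) atTop (𝓝 (f (q t))) := by
    intro t
    choose ξ hξ e using fun n => hgf (φ n) (h (φ n) t)
    simp only [e]
    apply (hf.tendsto _).comp
    have h1 : Tendsto (fun n => ξ n - h (φ n) t) atTop (𝓝 0) := by
      apply squeeze_zero_norm (a := fun n => 1/((φ n:ℝ)+1)) (fun n => hξ n)
      exact tendsto_one_div_add_atTop_nhds_zero_nat.comp hφ.tendsto_atTop
    have := h1.add (hlim t)
    simpa using this
  have ht : Tendsto (fun n => Fc (fun t => (g (φ n) (h (φ n) t) : ℂ) + ((h (φ n) t - t : ℝ) : ℂ) * Complex.I) ((k+1:ℕ):ℤ)) atTop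
      (𝓝 (Fc (fun t => (f (q t) : ℂ) + ((q t - t : ℝ) : ℂ) * Complex.I) ((k+1:ℕ):ℤ))) := by
    unfold Fc
    apply intervalIntegral.tendsto_integral_filter_of_dominated_convergence (fun _ => M + 4*π)
    · refine Eventually.of_forall fun n => Continuous.aestronglyMeasurable ?_
      have := hgc (φ n)
      have := (hh (φ n)).cont
      fun_prop
    · refine Eventually.of_forall fun n => Eventually.of_forall fun t _ => ?_
      rw [norm_mul, norm_exp_I, mul_one]
      refine (norm_add_le _ _).trans (add_le_add ?_ ?_)
      · rw [Complex.norm_real]; exact hgM _ _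
      · rw [norm_mul, Complex.norm_I, mul_one, Complex.norm_real]
        exact (hh _).close (h0 _).1 (h0 _).2 t
    · exact intervalIntegrable_const
    · refine Eventually.of_forall fun t _ => ?_
      apply Tendsto.mul_const
      apply Tendsto.add
      · exact (Complex.continuous_ofReal.tendsto _).comp (hu t)
      · exact ((Complex.continuous_ofReal.tendsto _).comp ((hlim t).sub_const t)).mul_const _
  simp only [hc] at ht
  exact (tendsto_nhds_unique ht tendsto_const_nhds)

lemma sin_half_ge {δ τ : ℝ} (h0 : 0 < δ) (h1 : δ ≤ τ) (h2 : τ ≤ 2*π-δ) : Real.sin (δ/2) ≤ Real.sin (τ/2) := by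
  rcases le_total τ π with h | h
  · exact Real.sin_le_sin_of_le_of_le_pi_div_two (by linarith [Real.pi_pos]) (by linarith) (by linarith)
  · rw [← Real.sin_pi_sub (τ/2)]
    exact Real.sin_le_sin_of_le_of_le_pi_div_two (by linarith [Real.pi_pos]) (by linarith) (by linarith)

lemma exp_cs (τ : ℝ) : Complex.exp (Complex.I * τ) = (Real.cos τ : ℂ) + (Real.sin τ : ℂ) * Complex.I := by
  rw [mul_comm, Complex.exp_mul_I]; push_cast; rfl

lemma norm_one_sub_sq (ρ τ : ℝ) : ‖1 - (ρ:ℂ) * Complex.exp (Complex.I * τ)‖^2 = (1-ρ)^2 + 4*ρ*Real.sin (τ/2)^2 := by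
  rw [← Complex.normSq_eq_norm_sq, exp_cs, Complex.normSq_apply]
  simp only [Complex.sub_re, Complex.sub_im, Complex.one_re, Complex.one_im, Complex.re_ofReal_mul, Complex.im_ofReal_mul,
    Complex.add_re, Complex.add_im, Complex.ofReal_re, Complex.ofReal_im, Complex.I_re, Complex.I_im]
  have e : Real.cos τ = 1 - 2*Real.sin (τ/2)^2 := by
    have h1 := Real.cos_two_mul (τ/2)
    rw [mul_div_cancel₀ _ (two_ne_zero)] at h1
    linarith [Real.sin_sq_add_cos_sq (τ/2)]
  linear_combination ρ^2 * Real.sin_sq_add_cos_sq τ - 2 * ρ * e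

lemma zeta_ker {τ : ℝ} (hs : Real.sin (τ/2) ≠ 0) :
    Complex.exp (Complex.I * τ) / (1 - Complex.exp (Complex.I * τ))^2 = -((ker τ : ℝ) : ℂ) := by
  have e : Complex.exp (Complex.I * τ) = Complex.exp (Complex.I * (τ/2 : ℝ))^2 := by
    rw [← Complex.exp_nat_mul]; congr 1; push_cast; ring
  have e1 : (1 - Complex.exp (Complex.I * τ)) = -2 * Complex.I * (Real.sin (τ/2):ℂ) * Complex.exp (Complex.I * (τ/2 : ℝ)) := by
    rw [e, exp_cs]
    have h := Real.sin_sq_add_cos_sq (τ/2)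
    have h' : ((Real.sin (τ/2):ℂ))^2 + ((Real.cos (τ/2):ℂ))^2 = 1 := by exact_mod_cast h
    linear_combination (-1:ℂ) * h' + (-(Real.sin (τ/2):ℂ)^2 + 2 * (Real.sin (τ/2):ℂ)^2) * Complex.I_sq
  have hs' : (Real.sin (τ/2):ℂ) ≠ 0 := by exact_mod_cast hs
  have hne := Complex.exp_ne_zero (Complex.I * (τ/2 : ℝ))
  rw [e1, e, ker]
  push_cast
  rw [mul_pow, mul_pow, mul_pow, Complex.I_sq]
  field_simp
  ring

lemma vanish {g : ℝ → ℂ} (hg : Continuous g) (hp : Function.Periodic g (2*π))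
    (h : ∀ m : ℕ, Fc g ((m+1:ℕ):ℤ) = 0) (c : ℝ) {δ : ℝ} (hδ : 0 < δ) (hδ1 : δ < π) (hz : ∀ τ, |τ| ≤ δ → g (c+τ) = 0) :
    IntervalIntegrable (fun τ => g (c+τ) * (ker τ : ℂ)) volume 0 (2*π) ∧ ∫ τ in (0:ℝ)..2*π, g (c+τ) * (ker τ : ℂ) = 0 := by
  obtain ⟨M, hM⟩ : ∃ M, ∀ x ∈ Icc c (c + 2*π), ‖g x‖ ≤ M :=
    isCompact_Icc.exists_bound_of_continuousOn hg.continuousOn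
  have hz2 : ∀ τ, 0 < τ → τ ≤ 2*π → g (c+τ) ≠ 0 → Real.sin (δ/2) ≤ Real.sin (τ/2) := by
    intro τ h0 h1 hne
    apply sin_half_ge hδ
    · by_contra hlt
      exact hne (hz τ (by rw [abs_of_pos h0]; linarith))
    · by_contra hlt
      apply hne
      have := hz (τ-2*π) (by rw [abs_of_nonpos (by linarith)]; linarith)
      rw [← this, ← hp (c + (τ-2*π))]; congr 1; ring
  have hσ : 0 < Real.sin (δ/2) := Real.sin_pos_of_pos_of_lt_pi (by linarith) (by linarith)
  set σ := Real.sin (δ/2) with hσd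
  have hM0 : 0 ≤ M := (norm_nonneg _).trans (hM c (by constructor <;> linarith [Real.pi_pos]))
  have hk := ker_meas
  have hint : IntervalIntegrable (fun τ => g (c+τ) * (ker τ : ℂ)) volume 0 (2*π) := by
    rw [intervalIntegrable_iff_integrableOn_Ioc_of_le (by positivity)]
    have hm : Measurable fun τ => g (c+τ) * (ker τ : ℂ) := by fun_prop
    apply Measure.integrableOn_of_bounded (M := M * (1/(4*σ^2))) measure_Ioc_lt_top.ne hm.aestronglyMeasurable
    · refine (ae_restrict_iff' measurableSet_Ioc).2 (Eventually.of_forall fun τ hτ => ?_)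
      by_cases hne : g (c+τ) = 0
      · rw [hne, zero_mul, norm_zero]; positivity
      have h1 := hz2 τ hτ.1 hτ.2 hne
      rw [norm_mul, Complex.norm_real, Real.norm_of_nonneg (ker_nonneg _)]
      apply mul_le_mul (hM _ ⟨by linarith [hτ.1], by linarith [hτ.2]⟩) _ (ker_nonneg _) hM0
      unfold ker; gcongr
  refine ⟨hint, ?_⟩
  set ρ : ℕ → ℝ := fun n => 1 - 1/((n:ℝ)+1+1) with hρ
  have hρ0 : ∀ n, 1/2 ≤ ρ n := fun n => by
    have : 1/((n:ℝ)+1+1) ≤ 1/2 := by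
      rw [div_le_div_iff₀ (by positivity) (by norm_num)]
      have : (0:ℝ) ≤ n := by positivity
      linarith
    simp only [hρ]; linarith
  have hρ1 : ∀ n, ρ n < 1 := fun n => by
    have : 0 < 1/((n:ℝ)+1+1) := by positivity
    simp only [hρ]; linarith
  have hρt : Tendsto ρ atTop (𝓝 1) := by
    have h1 : Tendsto (fun n : ℕ => 1/((n:ℝ)+1)) atTop (𝓝 0) := tendsto_one_div_add_atTop_nhds_zero_nat
    have := (h1.comp (tendsto_add_atTop_nat 1)).const_sub 1
    simpa [Function.comp_def, hρ] using this
  have hzero : ∀ n, ∫ τ in (0:ℝ)..2*π, g (c+τ) * (((ρ n:ℂ) * Complex.exp (Complex.I * τ)) / (1 - (ρ n:ℂ) * Complex.exp (Complex.I * τ))^2) = 0 := by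
    intro n
    have h0 : 0 ≤ ρ n := by linarith [hρ0 n]
    have := hasSum_pair hg hp c _ (summable_geo2 h0 (hρ1 n)) _ (fun τ => hasSum_geo2 h0 (hρ1 n) τ)
    simp only [h, mul_zero] at this
    exact this.unique hasSum_zero
  have ht : Tendsto (fun n => ∫ τ in (0:ℝ)..2*π, g (c+τ) * (((ρ n:ℂ) * Complex.exp (Complex.I * τ)) / (1 - (ρ n:ℂ) * Complex.exp (Complex.I * τ))^2))
      atTop (𝓝 (∫ τ in (0:ℝ)..2*π, g (c+τ) * (-(ker τ : ℂ)))) := by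
    apply intervalIntegral.tendsto_integral_filter_of_dominated_convergence (fun _ => M * (1/(2*σ^2)))
    · exact Eventually.of_forall fun n => Measurable.aestronglyMeasurable (by fun_prop)
    · refine Eventually.of_forall fun n => Eventually.of_forall fun τ hτ => ?_
      rw [uIoc_of_le (by positivity)] at hτ
      by_cases hne : g (c+τ) = 0
      · rw [hne, zero_mul, norm_zero]; positivity
      have h1 := hz2 τ hτ.1 hτ.2 hne
      have h0 : 0 ≤ ρ n := by linarith [hρ0 n]
      rw [norm_mul, norm_div, norm_rho_exp h0, norm_pow, norm_one_sub_sq]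
      apply mul_le_mul (hM _ ⟨by linarith [hτ.1], by linarith [hτ.2]⟩) _ (by positivity) hM0
      apply div_le_div₀ zero_le_one (hρ1 n).le (by positivity)
      have h2 : σ^2 ≤ Real.sin (τ/2)^2 := pow_le_pow_left₀ hσ.le h1 2
      nlinarith [sq_nonneg (1 - ρ n), mul_nonneg (sub_nonneg.2 (hρ0 n)) (sq_nonneg (Real.sin (τ/2)))]
    · exact intervalIntegrable_const
    · refine Eventually.of_forall fun τ hτ => ?_
      rw [uIoc_of_le (by positivity)] at hτ
      by_cases hne : g (c+τ) = 0
      · simp only [hne, zero_mul]; exact tendsto_const_nhds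
      have h1 := hz2 τ hτ.1 hτ.2 hne
      have hs : Real.sin (τ/2) ≠ 0 := (hσ.trans_le h1).ne'
      rw [← zeta_ker hs]
      apply Tendsto.const_mul
      have hρc : Tendsto (fun n => (ρ n : ℂ)) atTop (𝓝 1) := by
        have := (Complex.continuous_ofReal.tendsto 1).comp hρt
        simpa [Function.comp_def] using this
      have hd : (1 - Complex.exp (Complex.I * τ))^2 ≠ 0 := by
        have := norm_one_sub_sq 1 τ
        apply pow_ne_zero
        intro h0
        simp only [Complex.ofReal_one, one_mul, h0] at this
        simp at this
        exact hs this
      have := (hρc.mul_const (Complex.exp (Complex.I * τ))).div (((hρc.mul_const (Complex.exp (Complex.I * τ))).const_sub 1).pow 2) (by simpa using hd)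
      simp only [one_mul] at this
      exact this
  simp only [hzero] at ht
  have := tendsto_nhds_unique tendsto_const_nhds ht
  simp only [mul_neg, intervalIntegral.integral_neg] at this
  exact (neg_eq_zero.1 this.symm)

end JW


namespace JW
open Real MeasureTheory Set Filter Topology

lemma lift_strict {f h : ℝ → ℝ} (hf : Continuous f) (hfp : Function.Periodic f (2*π)) (hh : IsLift h)
    (hc : ∀ k : ℕ, Fc (fun t => (f (h t) : ℂ) + ((h t - t : ℝ) : ℂ) * Complex.I) ((k+1:ℕ):ℤ) = 0) : StrictMono h := by
  have hπ := Real.pi_pos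
  have hhc := hh.cont
  intro a b hab
  by_contra hnot
  have hconst : ∀ x, a ≤ x → x ≤ b → h x = h a := fun x h1 h2 =>
    le_antisymm ((hh.mono h2).trans (not_lt.1 hnot)) (hh.mono h1)
  set δ := min ((b-a)/4) 1 with hδ
  have hδ0 : 0 < δ := lt_min (by linarith) one_pos
  have hδ1 : δ ≤ (b-a)/4 := min_le_left _ _
  have hδ2 : δ ≤ 1 := min_le_right _ _
  set c := (a+b)/2 with hcd
  set w : ℝ → ℂ := fun t => (f (h t) : ℂ) + ((h t - t : ℝ) : ℂ) * Complex.I with hw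
  have hwp : Function.Periodic w (2*π) := fun t => by
    simp only [hw, hh.per]; rw [hfp, add_sub_add_right_eq_sub]
  have hwc : Continuous w := by fun_prop
  set g : ℝ → ℂ := fun t => w (δ + t) - w t + (δ : ℂ) * Complex.I with hg
  have hgc : Continuous g := by fun_prop
  have hgp : Function.Periodic g (2*π) := fun t => by
    simp only [hg]; rw [← add_assoc, hwp, hwp]
  have hgF : ∀ m : ℕ, Fc g ((m+1:ℕ):ℤ) = 0 := by
    intro m
    have e1 := Fc_shift hwp δ ((m+1:ℕ):ℤ)
    have e2 := hc m
    have e3 := Fc_one m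
    rw [e2, mul_zero] at e1
    have : Fc g ((m+1:ℕ):ℤ) = Fc (fun τ => w (δ + τ)) ((m+1:ℕ):ℤ) - Fc w ((m+1:ℕ):ℤ) + ((δ : ℂ) * Complex.I) * Fc (fun _ => 1) ((m+1:ℕ):ℤ) := by
      unfold Fc
      rw [← intervalIntegral.integral_sub (Continuous.intervalIntegrable (by fun_prop) _ _) (Continuous.intervalIntegrable (by fun_prop) _ _),
        ← intervalIntegral.integral_const_mul,
        ← intervalIntegral.integral_add (Continuous.intervalIntegrable (by fun_prop) _ _) (Continuous.intervalIntegrable (by fun_prop) _ _)]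
      congr 1; ext t; simp only [hg]; ring
    rw [this, e1, e2, e3]; simp
  have hgv : ∀ t, g t = ((f (h (δ+t)) - f (h t) : ℝ) : ℂ) + ((h (δ+t) - h t : ℝ) : ℂ) * Complex.I := by
    intro t; simp only [hg, hw]; push_cast; ring
  have hz : ∀ τ, |τ| ≤ δ → g (c+τ) = 0 := by
    intro τ hτ
    rw [abs_le] at hτ
    have e1 := hconst (c+τ) (by linarith [hτ.1]) (by linarith [hτ.2])
    have e2 := hconst (δ+(c+τ)) (by linarith [hτ.1]) (by linarith [hτ.2])
    rw [hgv, e1, e2]; simp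
  obtain ⟨hi, h0⟩ := vanish hgc hgp hgF c hδ0 (by linarith [Real.pi_gt_three]) hz
  have him : ∀ t, (g t).im = h (δ+t) - h t := fun t => by rw [hgv]; simp
  have hnn : ∀ t, 0 ≤ h (δ+t) - h t := fun t => sub_nonneg.2 (hh.mono (by linarith))
  have h1 : ∫ τ in (0:ℝ)..2*π, (h (δ+(c+τ)) - h (c+τ)) * ker τ = 0 := by
    have h2 := congrArg Complex.im h0
    rw [← Complex.imCLM_apply, ← ContinuousLinearMap.intervalIntegral_comp_comm _ hi] at h2
    simpa [him] using h2
  have hi1 : IntervalIntegrable (fun τ => (h (δ+(c+τ)) - h (c+τ)) * ker τ) volume 0 (2*π) := by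
    have := Complex.imCLM.integrable_comp ((integrable_μ_iff _).2 hi)
    rw [← integrable_μ_iff]
    refine this.congr (Eventually.of_forall fun τ => ?_)
    simp [him]
  have h2 : ∫ τ in (0:ℝ)..2*π, (h (δ+(c+τ)) - h (c+τ)) * (1/4) ≤ ∫ τ in (0:ℝ)..2*π, (h (δ+(c+τ)) - h (c+τ)) * ker τ := by
    apply intervalIntegral.integral_mono_on_of_le_Ioo (by positivity) (Continuous.intervalIntegrable (by fun_prop) _ _) hi1
    intro τ hτ
    apply mul_le_mul_of_nonneg_left _ (hnn _)
    have hs : 0 < Real.sin (τ/2) := Real.sin_pos_of_pos_of_lt_pi (by linarith [hτ.1]) (by linarith [hτ.2])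
    have hs1 := Real.sin_le_one (τ/2)
    unfold ker
    apply one_div_le_one_div_of_le (by positivity)
    nlinarith
  have h3 : ∫ τ in (0:ℝ)..2*π, (h (δ+(c+τ)) - h (c+τ)) = 2*π*δ := by
    have e : ∀ τ, h (δ+(c+τ)) - h (c+τ) = (fun t => h t - t) ((δ+c)+τ) - (fun t => h t - t) (c+τ) + δ := by
      intro τ; simp only; rw [add_assoc]; ring
    simp only [e]
    have k1 := periodic_shift hh.vper (δ+c)
    have k2 := periodic_shift hh.vper c
    rw [intervalIntegral.integral_add (Continuous.intervalIntegrable (by fun_prop) _ _) (Continuous.intervalIntegrable (by fun_prop) _ _),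
      intervalIntegral.integral_sub (Continuous.intervalIntegrable (by fun_prop) _ _) (Continuous.intervalIntegrable (by fun_prop) _ _), k1, k2]
    simp
  rw [h1, intervalIntegral.integral_mul_const, h3] at h2
  have : 0 < 2*π*δ := by positivity
  linarith

end JW

namespace JW
open Real MeasureTheory Set Filter Topology

lemma lift_surj {h : ℝ → ℝ} (hh : IsLift h) : Function.Surjective h := by
  have hn : ∀ n : ℕ, h (n * (2*π)) = h 0 + n * (2*π) ∧ h (-(n * (2*π))) = h 0 - n * (2*π) := by
    intro n
    induction n with
    | zero => simp
    | succ k ih =>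
      refine ⟨?_, ?_⟩
      · have := hh.per (k * (2*π))
        push_cast
        rw [show ((k:ℝ)+1) * (2*π) = k * (2*π) + 2*π by ring, this, ih.1]; ring
      · have := hh.per (-(((k+1:ℕ):ℝ) * (2*π)))
        rw [show -(((k+1:ℕ):ℝ) * (2*π)) + 2*π = -(k * (2*π)) by push_cast; ring, ih.2] at this
        push_cast at this ⊢
        linarith
  intro y
  obtain ⟨n, hn1⟩ := exists_nat_gt (|y - h 0| / (2*π))
  rw [div_lt_iff₀ (by positivity)] at hn1
  have h2 := abs_lt.1 hn1
  have hnn : 0 ≤ (n:ℝ) * (2*π) := by positivity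
  have := intermediate_value_Icc (f := h) (a := -(n * (2*π))) (b := n * (2*π)) (by linarith) hh.cont.continuousOn
  obtain ⟨x, -, hx⟩ := this (show y ∈ _ by
    rw [(hn n).1, (hn n).2]; constructor <;> linarith)
  exact ⟨x, hx⟩

lemma bv_lift {h : ℝ → ℝ} (hh : IsLift h) (c : ℝ) : BoundedVariationOn (fun t => h t - t - c) (Set.Icc 0 (2*π)) := by
  have hm : Monotone (fun t => h t + t) := fun x y hxy => add_le_add (hh.mono hxy) hxy
  have hw : eVariationOn (fun t => h t + t) (Set.Icc 0 (2*π)) ≠ ⊤ := by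
    have := (hm.monotoneOn (Set.Icc 0 (2*π))).eVariationOn_le (a := 0) (b := 2*π) (by simp [Real.pi_nonneg]) (by simp [Real.pi_nonneg])
    rw [Set.inter_self] at this
    exact ne_top_of_le_ne_top ENNReal.ofReal_ne_top this
  refine ne_top_of_le_ne_top hw ?_
  unfold eVariationOn
  refine iSup_mono fun p => Finset.sum_le_sum fun i _ => ?_
  have hu := p.2.2.1 (Nat.le_succ i)
  simp only [Nat.succ_eq_add_one] at hu
  have hu2 := hh.mono hu
  rw [edist_dist, edist_dist]
  apply ENNReal.ofReal_le_ofReal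
  rw [Real.dist_eq, Real.dist_eq, abs_le]
  have := le_abs_self (h (p.2.1 (i+1)) + p.2.1 (i+1) - (h (p.2.1 i) + p.2.1 i))
  constructor <;> linarith

section
variable [inst : Fact ((0 : ℝ) < 2 * π)]

lemma cont_lift {X : Type*} [TopologicalSpace X] {g : ℝ → X} (hg : Continuous g) (hp : Function.Periodic g (2*π)) :
    Continuous (hp.lift : AddCircle (2*π) → X) := by
  rw [(QuotientAddGroup.isQuotientMap_mk (N := AddSubgroup.zmultiples (2*π))).continuous_iff]
  exact hg

lemma coe_add_per {g : ℝ → ℝ} (hp : ∀ t, g (t + 2*π) = g t + 2*π) :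
    Function.Periodic (fun t => ((g t : ℝ) : AddCircle (2*π))) (2*π) := by
  intro t
  simp only [hp, AddCircle.coe_add_period]

lemma exists_homeo {h : ℝ → ℝ} (hh : IsLift h) (hs : StrictMono h) :
    ∃ H : AddCircle (2*π) ≃ₜ AddCircle (2*π), ∀ t : ℝ, H (t : AddCircle (2*π)) = ((h t : ℝ) : AddCircle (2*π)) := by
  let e := hs.orderIsoOfSurjective h (lift_surj hh)
  have he : ∀ t, e t = h t := fun t => rfl
  have hg : ∀ t, e.symm (t + 2*π) = e.symm t + 2*π := by
    intro t
    apply e.injective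
    rw [e.apply_symm_apply, he, hh.per, ← he, e.apply_symm_apply]
  have p1 := coe_add_per hh.per
  have p2 := coe_add_per (g := e.symm) hg
  have c1 := cont_lift ((AddCircle.continuous_mk' (2*π)).comp hh.cont) p1
  have c2 := cont_lift ((AddCircle.continuous_mk' (2*π)).comp e.symm.continuous) p2
  refine ⟨⟨⟨p1.lift, p2.lift, ?_, ?_⟩, c1, c2⟩, fun t => rfl⟩
  · intro x
    induction x using QuotientAddGroup.induction_on with
    | H t =>
      show ((e.symm (h t) : ℝ) : AddCircle (2*π)) = (t : AddCircle (2*π))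
      rw [← he, e.symm_apply_apply]
  · intro x
    induction x using QuotientAddGroup.induction_on with
    | H t =>
      show ((h (e.symm t) : ℝ) : AddCircle (2*π)) = (t : AddCircle (2*π))
      rw [← he, e.apply_symm_apply]

lemma fc_eq (g : AddCircle (2*π) → ℂ) (k : ℤ) :
    fourierCoeff g k = (1/(2*π):ℂ) * Fc (fun t => g (t : AddCircle (2*π))) (-k) := by
  rw [fourierCoeff_eq_intervalIntegral g k 0, zero_add, Fc]
  rw [Complex.real_smul]
  push_cast
  congr 1
  refine intervalIntegral.integral_congr fun t _ => ?_
  simp only [fourier_coe_apply, smul_eq_mul]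
  rw [mul_comm]
  congr 2
  have : (π:ℂ) ≠ 0 := by exact_mod_cast Real.pi_ne_zero
  push_cast
  field_simp

lemma fc_conj (g : ℝ → ℝ) (k : ℤ) :
    Fc (fun t => (g t : ℂ)) (-k) = (starRingEnd ℂ) (Fc (fun t => (g t : ℂ)) k) := by
  unfold Fc
  rw [intervalIntegral.integral_of_le (by positivity), intervalIntegral.integral_of_le (by positivity), ← integral_conj]
  congr 1
  ext t
  simp [← Complex.exp_conj]

lemma fourier_part {F V : ℝ → ℝ} 
    (h0 : Fc (fun t => (V t : ℂ)) 0 = 0)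
    (hk : ∀ k : ℕ, Fc (fun t => (V t : ℂ)) ((k+1:ℕ):ℤ) = Complex.I * Fc (fun t => (F t : ℂ)) ((k+1:ℕ):ℤ)) (k : ℤ) :
    Fc (fun t => (V t : ℂ)) (-k) = -Complex.I * (k.sign : ℂ) * Fc (fun t => (F t : ℂ)) (-k) := by
  rcases lt_trichotomy k 0 with h | h | h
  · obtain ⟨n, hn⟩ : ∃ n : ℕ, -k = ((n+1:ℕ):ℤ) := ⟨(-k-1).toNat, by omega⟩
    rw [hn, hk, Int.sign_eq_neg_one_of_neg h]; simp
  · subst h; simpa using h0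
  · obtain ⟨n, hn⟩ : ∃ n : ℕ, k = ((n+1:ℕ):ℤ) := ⟨(k-1).toNat, by omega⟩
    rw [Int.sign_eq_one_of_pos h, fc_conj, fc_conj, hn, hk]; simp

end
end JW

open scoped Real

/-- Strengthened Jurkat–Waterman theorem: the homeomorphism `h` and the conjugate function `v`
of `f ∘ h` can both be chosen with the logarithmic modulus of continuity. -/
theorem jurkat_waterman_log_modulus
    [inst : Fact ((0 : ℝ) < 2 * π)]
    (f : AddCircle (2 * π) → ℝ) (hf : Continuous f) :
    ∃ (h : AddCircle (2 * π) ≃ₜ AddCircle (2 * π)) (v : AddCircle (2 * π) → ℝ),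
      Continuous v ∧
      BoundedVariationOn (fun t : ℝ => v (t : AddCircle (2 * π))) (Set.Icc 0 (2 * π)) ∧
      (∀ k : ℤ,
        fourierCoeff (fun t => (v t : ℂ)) k =
          -Complex.I * (k.sign : ℂ) * fourierCoeff (fun t => ((f (h t) : ℝ) : ℂ)) k) ∧
      ∃ C : ℝ, 0 < C ∧
        ∀ s t : AddCircle (2 * π), 0 < dist s t → dist s t ≤ 1 / 2 →
          |v s - v t| ≤ C / Real.log (1 / dist s t) ∧
          dist (h s) (h t) ≤ C / Real.log (1 / dist s t) := by
  obtain ⟨M, hM⟩ : ∃ M : ℝ, ∀ x, |f x| ≤ M := by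
    obtain ⟨M, hM⟩ := (isCompact_univ (X := AddCircle (2*π))).exists_bound_of_continuousOn hf.continuousOn
    exact ⟨M, fun x => hM x (Set.mem_univ x)⟩
  have hM0 : 0 ≤ M := (abs_nonneg _).trans (hM 0)
  have hFc : Continuous (fun t : ℝ => f (t : AddCircle (2*π))) := hf.comp (AddCircle.continuous_mk' _)
  have hFp : Function.Periodic (fun t : ℝ => f (t : AddCircle (2*π))) (2*π) := fun t => by
    simp only [AddCircle.coe_add_period]
  obtain ⟨h, hh, hc⟩ := JW.exists_conj hFc hFp (M := M) (fun t => hM _)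
  have hs := JW.lift_strict hFc hFp hh hc
  obtain ⟨H, hH⟩ := JW.exists_homeo hh hs
  have hhc := hh.cont
  set c : ℝ := (1/(2*π)) * ∫ t in (0:ℝ)..2*π, (h t - t) with hcdef
  have hvp : Function.Periodic (fun t => h t - t - c) (2*π) := fun t => by
    have := hh.vper t
    simp only at this ⊢
    rw [this]
  have hvc : Continuous (fun t => h t - t - c) := by fun_prop
  have hπ := Real.pi_pos
  refine ⟨H, hvp.lift, JW.cont_lift hvc hvp, JW.bv_lift hh c, ?_, ?_⟩
  · intro k
    rw [JW.fc_eq, JW.fc_eq]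
    simp only [Function.Periodic.lift_coe, hH]
    rw [JW.fourier_part (F := fun t => f (h t : AddCircle (2*π))) (V := fun t => h t - t - c) ?_ ?_ k]
    · ring
    · unfold JW.Fc
      simp only [Int.cast_zero, mul_zero, zero_mul, Complex.exp_zero, mul_one]
      rw [intervalIntegral.integral_ofReal,
        intervalIntegral.integral_sub (Continuous.intervalIntegrable (by fun_prop) _ _) (Continuous.intervalIntegrable (by fun_prop) _ _)]
      rw [intervalIntegral.integral_const, hcdef, smul_eq_mul, sub_zero, ← mul_assoc, mul_one_div_cancel (by positivity)]
      simp
    · intro m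
      have h1 := hc m
      rw [JW.Fc_comb (u := fun t => f (h t : AddCircle (2*π))) (v := fun t => h t - t) (hFc.comp hhc) (by fun_prop)] at h1
      have h2 : JW.Fc (fun t => ((h t - t - c : ℝ) : ℂ)) ((m+1:ℕ):ℤ) =
          JW.Fc (fun t => ((h t - t : ℝ) : ℂ)) ((m+1:ℕ):ℤ) - c * JW.Fc (fun _ => 1) ((m+1:ℕ):ℤ) := by
        unfold JW.Fc
        rw [← intervalIntegral.integral_const_mul, ← intervalIntegral.integral_sub (Continuous.intervalIntegrable (by fun_prop) _ _) (Continuous.intervalIntegrable (by fun_prop) _ _)]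
        congr 1; ext t; push_cast; ring
      rw [h2, JW.Fc_one, mul_zero, sub_zero]
      have hI := Complex.I_mul_I
      linear_combination (-Complex.I) * h1 + JW.Fc (fun t => ((h t - t : ℝ) : ℂ)) ((m+1:ℕ):ℤ) * hI
  · refine ⟨2*π*M+2*π+1, by positivity, fun s t hd0 hd => ?_⟩
    obtain ⟨a, rfl⟩ := QuotientAddGroup.mk_surjective t
    obtain ⟨x, hx⟩ := QuotientAddGroup.mk_surjective (s - (a : AddCircle (2*π)))
    obtain ⟨y, hy1, hy2⟩ : ∃ y : ℝ, s = ((a + y : ℝ) : AddCircle (2*π)) ∧ |y| = dist s (a : AddCircle (2*π)) := by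
      refine ⟨x - round ((2*π)⁻¹ * x) * (2*π), ?_, ?_⟩
      · have e : ((round ((2*π)⁻¹ * x) * (2*π) : ℝ) : AddCircle (2*π)) = 0 := by
          rw [← zsmul_eq_mul, AddCircle.coe_zsmul, AddCircle.coe_period, zsmul_zero]
        rw [AddCircle.coe_add, AddCircle.coe_sub, e, sub_zero]
        exact (add_eq_of_eq_sub' hx).symm
      · rw [dist_eq_norm, ← AddCircle.norm_eq]
        exact congrArg norm hx
    change 0 < dist s (a : AddCircle (2*π)) at hd0
    change dist s (a : AddCircle (2*π)) ≤ 1/2 at hd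
    change |hvp.lift s - hvp.lift (a : AddCircle (2*π))| ≤ _ / Real.log (1 / dist s (a : AddCircle (2*π))) ∧
      dist (H s) (H (a : AddCircle (2*π))) ≤ _ / Real.log (1 / dist s (a : AddCircle (2*π)))
    rw [← hy2] at hd0 hd ⊢
    set d := |y| with hdd
    have hm := JW.conj_mod (u := fun t => f (h t : AddCircle (2*π))) hh (hFc.comp hhc)
      (fun t => by simp only [hh.per, AddCircle.coe_add_period]) (fun t => hM _) hc a hd0 hd
    have hlog : 0 < Real.log (1/d) := Real.log_pos (by rw [lt_div_iff₀ hd0]; linarith)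
    have hdl : d * Real.log (1/d) ≤ 1 := by
      have := Real.log_le_sub_one_of_pos (show 0 < 1/d by positivity)
      calc d * Real.log (1/d) ≤ d * (1/d - 1) := by gcongr
        _ = 1 - d := by field_simp
        _ ≤ 1 := by linarith
    have hya := abs_le.1 (le_refl |y|)
    have g1 : h (a - d) ≤ h a := hh.mono (by linarith)
    have g2 : h a ≤ h (a + d) := hh.mono (by linarith)
    have g3 : h (a - d) ≤ h (a + y) := hh.mono (by linarith [hya.1])
    have g4 : h (a + y) ≤ h (a + d) := hh.mono (by linarith [hya.2])
    have g5 : |h (a+y) - h a| ≤ h (a+d) - h (a-d) := by rw [abs_le]; constructor <;> linarith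
    constructor
    · rw [le_div_iff₀ hlog, hy1, Function.Periodic.lift_coe, Function.Periodic.lift_coe]
      have : |h (a+y) - (a+y) - c - (h a - a - c)| ≤ (h (a+d) - h (a-d)) + d := by
        rw [show h (a+y) - (a+y) - c - (h a - a - c) = (h (a+y) - h a) - y by ring]
        exact (abs_sub _ _).trans (add_le_add g5 le_rfl)
      calc _ ≤ ((h (a+d) - h (a-d)) + d) * Real.log (1/d) := by gcongr
        _ ≤ _ := by linarith
    · rw [le_div_iff₀ hlog, hy1, hH, hH, dist_eq_norm, ← AddCircle.coe_sub]
      have : ‖((h (a+y) - h a : ℝ) : AddCircle (2*π))‖ ≤ h (a+d) - h (a-d) :=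
        (QuotientAddGroup.norm_mk_le_norm).trans g5
      calc _ ≤ (h (a+d) - h (a-d)) * Real.log (1/d) := by gcongr
        _ ≤ _ := by linarith
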